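/- Let n ≥ 1. Suppose H_i : [0,1] × ℝ^{2n} → ℝ is a sequence of smooth functions for which there exists a single compact set K ⊂ ℝ^{2n} with supp H_i(t,·) ⊆ K for all i and all t ∈ [0,1]. Let φ_i : [0,1] × ℝ^{2n} → ℝ^{2n} be a Hamiltonian flow of H_i. Assume that H_i converges uniformly on [0,1] × ℝ^{2n} to a continuous function H, and that sup_{(t,x) ∈ [0,1] × ℝ^{2n}} |φ_i(t,x) − x| → 0 as i → ∞. Then H ≡ 0. (This is the C⁰-uniqueness theorem for compactly supported continuous Hamiltonian flows on a symplectic manifold bounded at infinity, instantiated on standard (ℝ^{2n}, ω₀).) -/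

import Mathlib

open MeasureTheory

/-- Phase space `ℝ^{2n} = ℝⁿ × ℝⁿ` with coordinates `x = (q, p)`. -/
abbrev Phase (n : ℕ) := EuclideanSpace ℝ (Fin n) × EuclideanSpace ℝ (Fin n)

/-- The Hamiltonian vector field of `H`:
`X_H(t,(q,p)) = (∂H/∂p(t,q,p), −∂H/∂q(t,q,p))`. -/
noncomputable def hamVF {n : ℕ} (H : ℝ × Phase n → ℝ) (t : ℝ) (x : Phase n) : Phase n :=
  (gradient (fun p => H (t, (x.1, p))) x.2, - gradient (fun q => H (t, (q, x.2))) x.1)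

/-- `φ` is a Hamiltonian flow of `H` on the time interval `[0,1]`:
`φ(0,x) = x` and `t ↦ φ(t,x)` has derivative `X_H(t, φ(t,x))` at every `t ∈ [0,1]`. -/
def IsHamFlow {n : ℕ} (H : ℝ × Phase n → ℝ) (φ : ℝ × Phase n → Phase n) : Prop :=
  (∀ x, φ (0, x) = x) ∧
    ∀ x : Phase n, ∀ t ∈ Set.Icc (0:ℝ) 1,
      HasDerivAt (fun s => φ (s, x)) (hamVF H t (φ (t, x))) t

/-- `t ↦ det (1 + tA)` is a polynomial, so Lagrange interpolation is exact for it. -/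
theorem det_one_add_eq_interpolate {E : Type*} [NormedAddCommGroup E] [NormedSpace ℝ E]
    [FiniteDimensional ℝ E] {s : Finset ℕ} {v : ℕ → ℝ} (hv : Set.InjOn v s)
    (hs : Module.finrank ℝ E < s.card) (A : E →L[ℝ] E) :
    (1 + A).det = ∑ j ∈ s, (1 + v j • A).det * (Lagrange.basis s v j).eval 1 := by
  let b : Module.Basis (Fin (Module.finrank ℝ E)) ℝ E := Module.finBasis ℝ E
  let M : Matrix (Fin (Module.finrank ℝ E)) (Fin (Module.finrank ℝ E)) ℝ :=
    LinearMap.toMatrix b b (A : E →ₗ[ℝ] E)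
  let p : Polynomial ℝ := ((Polynomial.X : Polynomial ℝ) • M.map (Polynomial.C : ℝ →+* Polynomial ℝ)
    + (1 : Matrix (Fin (Module.finrank ℝ E)) (Fin (Module.finrank ℝ E)) ℝ).map
      (Polynomial.C : ℝ →+* Polynomial ℝ)).det
  have hp : p.natDegree ≤ Module.finrank ℝ E := by
    simpa only [Fintype.card_fin] using Polynomial.natDegree_det_X_add_C_le M 1
  have hev : ∀ t : ℝ, p.eval t = (1 + t • A).det := by
    intro t
    change _ = LinearMap.det ((1 + t • A : E →L[ℝ] E) : E →ₗ[ℝ] E)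
    rw [← LinearMap.det_toMatrix b, ← Polynomial.coe_evalRingHom, RingHom.map_det]
    congr 1
    ext i j
    simp [M, LinearMap.toMatrix_apply, Matrix.one_apply, Finsupp.single_apply, add_comm,
      apply_ite, eq_comm, mul_comm t]
  have hd : p.degree < s.card :=
    lt_of_le_of_lt Polynomial.degree_le_natDegree (by exact_mod_cast lt_of_le_of_lt hp hs)
  have h := congrArg (Polynomial.eval 1) (Lagrange.eq_interpolate hv hd)
  rw [Lagrange.interpolate_apply, Polynomial.eval_finsetSum, hev] at h
  simpa [hev] using h

/-- A `C¹` vector field on a closed ball vanishing on the sphere, extended by zero, is Lipschitz. -/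
theorem exists_approximatesLinearOn_indicator {E : Type*} [NormedAddCommGroup E]
    [NormedSpace ℝ E] [FiniteDimensional ℝ E] {v : E → E} (hv : ContDiff ℝ 1 v) {R : ℝ}
    (hR : 0 ≤ R) (hvR : ∀ x, ‖x‖ = R → v x = 0) :
    ∃ C : ℝ, 0 ≤ C ∧ ∀ x y,
      ‖(Metric.closedBall (0 : E) R).indicator v x - (Metric.closedBall (0 : E) R).indicator v y‖
        ≤ C * ‖x - y‖ := by
  set B := Metric.closedBall (0 : E) R
  have hBc : IsCompact B := isCompact_closedBall _ _
  obtain ⟨C, hC⟩ := hBc.exists_bound_of_continuousOn (f := fderiv ℝ v)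
    (hv.continuous_fderiv (by norm_num)).continuousOn
  have hC0 : 0 ≤ C := le_trans (norm_nonneg _) (hC 0 (by simpa [B] using hR))
  have hin : ∀ x ∈ B, ∀ y ∈ B, ‖v x - v y‖ ≤ C * ‖x - y‖ := fun x hx y hy =>
    Convex.norm_image_sub_le_of_norm_fderiv_le
      (fun z _ => (hv.differentiable (by norm_num)).differentiableAt) hC
      (convex_closedBall _ _) hy hx
  have hout : ∀ x ∈ B, ∀ y ∉ B, ‖v x‖ ≤ C * ‖x - y‖ := by
    intro x hx y hy
    have hx' : ‖x‖ ≤ R := by simpa [B] using hx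
    have hy' : R < ‖y‖ := by simpa [B] using hy
    have hcont : ContinuousOn (fun t : ℝ => ‖x + t • (y - x)‖) (Set.Icc 0 1) := by fun_prop
    obtain ⟨t, ht, hte⟩ := intermediate_value_Icc (zero_le_one) hcont
      (show R ∈ Set.Icc _ _ by simpa using ⟨hx', hy'.le⟩)
    have hz : v (x + t • (y - x)) = 0 := hvR _ hte
    have := hin x hx (x + t • (y - x)) (by simp only [B, mem_closedBall_zero_iff]; exact hte.le)
    rw [hz, sub_zero] at this
    refine this.trans (mul_le_mul_of_nonneg_left ?_ hC0)
    have : x - (x + t • (y - x)) = t • (x - y) := by module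
    rw [this, norm_smul, Real.norm_of_nonneg ht.1]
    exact mul_le_of_le_one_left (norm_nonneg _) ht.2
  refine ⟨C, hC0, fun x y => ?_⟩
  by_cases hx : x ∈ B <;> by_cases hy : y ∈ B
  · simpa [hx, hy] using hin x hx y hy
  · simpa [hx, hy] using hout x hx y hy
  · simpa [hx, hy, norm_sub_rev] using hout y hy x hx
  · simp only [Set.indicator_of_notMem hx, Set.indicator_of_notMem hy, sub_zero, norm_zero]
    positivity

/-- A `C¹` self-map of space restricting to the identity on a sphere has a nonsingular
derivative somewhere inside the ball. -/
theorem exists_det_fderiv_ne_zero {E : Type*} [NormedAddCommGroup E]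
    [InnerProductSpace ℝ E] [FiniteDimensional ℝ E] {r : E → E} (hr : ContDiff ℝ 1 r) {R : ℝ}
    (hR : 0 < R) (hrR : ∀ x, ‖x‖ = R → r x = x) :
    ∃ x, (fderiv ℝ r x).det ≠ 0 := by
  by_contra! hdet
  borelize E
  set B := Metric.closedBall (0 : E) R with hB
  have hBc : IsCompact B := isCompact_closedBall _ _
  set v : E → E := fun x => r x - x with hvdef
  have hv : ContDiff ℝ 1 v := hr.sub contDiff_id
  have hvd : ∀ x, HasFDerivAt v (fderiv ℝ v x) x := fun x =>
    ((hv.differentiable (by norm_num)).differentiableAt).hasFDerivAt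
  have hvc : Continuous (fderiv ℝ v) := hv.continuous_fderiv (by norm_num)
  have hrv : ∀ x, (1 + fderiv ℝ v x).det = 0 := by
    intro x
    rw [← hdet x]
    congr 1
    have : fderiv ℝ v x = fderiv ℝ r x - ContinuousLinearMap.id ℝ E := by
      rw [hvdef, fderiv_fun_sub ((hr.differentiable (by norm_num)).differentiableAt)
        differentiableAt_fun_id]
      simp
    rw [this]
    ext w
    simp
  obtain ⟨C, hC0, hC⟩ := exists_approximatesLinearOn_indicator hv hR.le
    (fun x hx => by simp [v, hrR x hx])
  obtain ⟨D, hD⟩ := hBc.exists_bound_of_continuousOn (f := fderiv ℝ v) hvc.continuousOn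
  have hD0 : 0 ≤ D := le_trans (norm_nonneg _) (hD 0 (by simpa [B] using hR.le))
  obtain ⟨ε, hε, hpos⟩ : ∃ ε > 0, ∀ A : E →L[ℝ] E, ‖A‖ < ε → 0 < (1 + A).det := by
    have hc : Continuous fun A : E →L[ℝ] E => (1 + A).det :=
      ContinuousLinearMap.continuous_det.comp (continuous_const.add continuous_id)
    have h1 : (0 : ℝ) < (1 + (0 : E →L[ℝ] E)).det := by
      have : ((1 : E →L[ℝ] E)).det = 1 := LinearMap.det_id
      rw [add_zero, this]
      exact one_pos
    obtain ⟨ε, hε, h⟩ := Metric.eventually_nhds_iff.1 (hc.continuousAt.eventually (lt_mem_nhds h1))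
    exact ⟨ε, hε, fun A hA => h (by simpa using hA)⟩
  have hmain : ∀ t : ℝ, 0 ≤ t → t * C < 1 → t * D < ε →
      ∫ x in B, (1 + t • fderiv ℝ v x).det = volume.real B := by
    intro t ht htC htD
    set f : E → E := fun x => x + t • B.indicator v x with hf
    have hapx : ApproximatesLinearOn f ((ContinuousLinearEquiv.refl ℝ E : E ≃L[ℝ] E) : E →L[ℝ] E)
        Set.univ (NNReal.mk (t * C) (by positivity)) := by
      intro x _ y _
      have : f x - f y - (x - y) = t • (B.indicator v x - B.indicator v y) := by
        simp only [hf]; module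
      simp only [ContinuousLinearEquiv.coe_refl, ContinuousLinearMap.coe_id', id]
      rw [this, norm_smul, Real.norm_of_nonneg ht, NNReal.coe_mk, mul_assoc]
      exact mul_le_mul_of_nonneg_left (hC x y) ht
    have hsm : Subsingleton E ∨ NNReal.mk (t * C) (by positivity) <
        ‖(((ContinuousLinearEquiv.refl ℝ E).symm : E ≃L[ℝ] E) : E →L[ℝ] E)‖₊⁻¹ := by
      rcases subsingleton_or_nontrivial E with h | h
      · exact Or.inl h
      · right
        have : ‖(((ContinuousLinearEquiv.refl ℝ E).symm : E ≃L[ℝ] E) : E →L[ℝ] E)‖₊ = 1 := by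
          ext
          simp
        rw [this, inv_one]
        exact_mod_cast htC
    have hsurj := hapx.surjective hsm
    have hinj : Function.Injective f :=
      Set.injOn_univ.1 (Set.injOn_iff_injective.2 (hapx.injective hsm))
    have hfout : ∀ x ∉ B, f x = x := fun x hx => by simp [hf, hx]
    have himg : f '' B = B := by
      ext y
      constructor
      · rintro ⟨x, hx, rfl⟩
        by_contra hn
        exact hn (by rw [hinj (hfout _ hn)]; exact hx)
      · intro hy
        obtain ⟨x, rfl⟩ := hsurj y
        refine ⟨x, ?_, rfl⟩
        by_contra hn
        exact hn (by rw [← hfout x hn]; exact hy)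
    have hder : ∀ x ∈ B, HasFDerivWithinAt f (1 + t • fderiv ℝ v x) B x := by
      intro x hx
      have h : HasFDerivWithinAt (fun x => x + t • v x) (1 + t • fderiv ℝ v x) B x :=
        ((hasFDerivAt_id x).add ((hvd x).const_smul t)).hasFDerivWithinAt
      exact h.congr (fun y hy => by simp [hf, hy]) (by simp [hf, hx])
    have := integral_image_eq_integral_abs_det_fderiv_smul volume
      hBc.measurableSet hder hinj.injOn (fun _ => (1 : ℝ))
    rw [himg] at this
    simp only [integral_const, smul_eq_mul, mul_one, measureReal_restrict_apply_univ] at this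
    rw [this]
    refine setIntegral_congr_fun hBc.measurableSet (fun x hx => ?_)
    refine (abs_of_pos (hpos _ ?_)).symm
    rw [norm_smul, Real.norm_of_nonneg ht]
    exact lt_of_le_of_lt (mul_le_mul_of_nonneg_left (hD x hx) ht) htD
  set d := Module.finrank ℝ E
  obtain ⟨τ, hτ, hτC, hτD⟩ : ∃ τ > 0, τ * d * C < 1 ∧ τ * d * D < ε := by
    refine ⟨min 1 ε / (2 * (d * C + d * D + 1)), by positivity, ?_, ?_⟩
    · rw [div_mul_eq_mul_div, div_mul_eq_mul_div, div_lt_one (by positivity)]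
      have h1 : min 1 ε ≤ 1 := min_le_left _ _
      have h3 : 0 ≤ d * C := by positivity
      have h4 : 0 ≤ d * D := by positivity
      nlinarith [mul_le_mul_of_nonneg_right h1 h3]
    · rw [div_mul_eq_mul_div, div_mul_eq_mul_div, div_lt_iff₀ (by positivity)]
      have h1 : min 1 ε ≤ ε := min_le_right _ _
      have h3 : 0 ≤ d * C := by positivity
      have h4 : 0 ≤ d * D := by positivity
      nlinarith [mul_le_mul_of_nonneg_right h1 h4, mul_nonneg hε.le h3, mul_nonneg hε.le h4]
  have hle : ∀ j ∈ Finset.range (d + 1), (j : ℝ) ≤ d := fun j hj => by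
    exact_mod_cast Nat.lt_succ_iff.1 (Finset.mem_range.1 hj)
  have hinj : Set.InjOn (fun j : ℕ => τ * j) (Finset.range (d + 1)) := by
    intro i _ j _ hij
    exact_mod_cast mul_left_cancel₀ hτ.ne' hij
  have hcont : ∀ t : ℝ, IntegrableOn (fun x => (1 + t • fderiv ℝ v x).det) B := fun t =>
    ContinuousOn.integrableOn_compact hBc (ContinuousLinearMap.continuous_det.comp
      (continuous_const.add (hvc.const_smul t))).continuousOn
  have hzero : ∑ j ∈ Finset.range (d + 1), volume.real B *
      (Lagrange.basis (Finset.range (d + 1)) (fun j : ℕ => τ * j) j).eval 1 = 0 := by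
    have h0 : ∫ x in B, (1 + fderiv ℝ v x).det = 0 := by simp [hrv]
    rw [← h0]
    rw [integral_congr_ae (Filter.Eventually.of_forall fun x =>
      det_one_add_eq_interpolate hinj (by simp [d]) (fderiv ℝ v x))]
    rw [integral_finsetSum _ (fun j _ => (hcont _).mul_const _)]
    refine Finset.sum_congr rfl fun j hj => ?_
    rw [integral_mul_const, hmain (τ * j) (by positivity)]
    · refine lt_of_le_of_lt ?_ hτC
      exact mul_le_mul_of_nonneg_right (mul_le_mul_of_nonneg_left (hle j hj) hτ.le) (by assumption)
    · refine lt_of_le_of_lt ?_ hτD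
      exact mul_le_mul_of_nonneg_right (mul_le_mul_of_nonneg_left (hle j hj) hτ.le) (by assumption)
  rw [← Finset.mul_sum, ← Polynomial.eval_finsetSum,
    Lagrange.sum_basis hinj (by simp), Polynomial.eval_one, mul_one] at hzero
  have hpos : 0 < volume.real B :=
    ENNReal.toReal_pos (Metric.measure_closedBall_pos volume _ hR).ne' hBc.measure_lt_top.ne
  exact hpos.ne' hzero

theorem exists_eq_zero_of_norm_sub_le {E : Type*} [NormedAddCommGroup E]
    [InnerProductSpace ℝ E] [FiniteDimensional ℝ E] {g : E → E} (hg : ContDiff ℝ 1 g) {M : ℝ}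
    (hM : ∀ x, ‖g x - x‖ ≤ M) : ∃ x, g x = 0 := by
  by_contra! hne
  have hM0 : 0 ≤ M := (norm_nonneg _).trans (hM 0)
  let χ : ContDiffBump (0 : E) := ⟨M + 1, M + 2, by linarith, by linarith⟩
  set G : E → E := fun x => x + χ x • (g x - x) with hG
  have hGd : ContDiff ℝ 1 G := contDiff_id.add (χ.contDiff.smul (hg.sub contDiff_id))
  have hG0 : ∀ x, G x ≠ 0 := by
    intro x hx
    by_cases h : ‖x‖ ≤ M + 1
    · have h1 : χ x = 1 := χ.one_of_mem_closedBall (by simpa [χ] using h)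
      exact hne x (by simpa [hG, h1] using hx)
    · have h2 : x = -(χ x • (g x - x)) := by
        rw [eq_neg_iff_add_eq_zero]; exact hx
      have h3 : ‖x‖ ≤ 1 * M := by
        conv_lhs => rw [h2]
        rw [norm_neg, norm_smul, Real.norm_of_nonneg χ.nonneg]
        exact mul_le_mul χ.le_one (hM x) (norm_nonneg _) zero_le_one
      linarith
  have hGout : ∀ x, ‖x‖ = M + 2 → G x = x := by
    intro x hx
    have h1 : χ x = 0 := χ.zero_of_le_dist (by simp [χ, hx])
    simp [hG, h1]
  set r : E → E := fun x => ((M + 2) * ‖G x‖⁻¹) • G x with hr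
  have hrd : ContDiff ℝ 1 r :=
    (contDiff_const.mul ((hGd.norm ℝ hG0).inv fun x => norm_ne_zero_iff.2 (hG0 x))).smul hGd
  have hrn : ∀ x, ‖r x‖ = M + 2 := by
    intro x
    have := norm_ne_zero_iff.2 (hG0 x)
    rw [hr, norm_smul, Real.norm_of_nonneg (by positivity)]
    field_simp
  obtain ⟨x, hx⟩ := exists_det_fderiv_ne_zero hrd (R := M + 2) (by linarith) (by
    intro x hx
    have : M + 2 ≠ 0 := by linarith
    simp [hr, hGout x hx, hx, this])
  let e := LinearMap.equivOfDetNeZero ((fderiv ℝ r x : E →L[ℝ] E) : E →ₗ[ℝ] E) hx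
  obtain ⟨w, hw⟩ := e.surjective (r x)
  have hw' : fderiv ℝ r x w = r x := hw
  have h1 := ((hrd.differentiable (by norm_num)).differentiableAt (x := x)).hasFDerivAt.norm_sq
  simp only [hrn] at h1
  have h2 := congrArg (fun A : E →L[ℝ] ℝ => A w) (h1.unique (hasFDerivAt_const _ x))
  simp [hw', hrn] at h2
  linarith

theorem exists_eq_of_norm_sub_linear_le {U : Type*} [NormedAddCommGroup U]
    [NormedSpace ℝ U] [FiniteDimensional ℝ U] {g : U → U} (hg : ContDiff ℝ 1 g) {T : U →L[ℝ] U}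
    (hT : Function.Injective T) {M : ℝ} (hM : ∀ x, ‖g x - T x‖ ≤ M) (c : U) : ∃ x, g x = c := by
  let J : U ≃L[ℝ] EuclideanSpace ℝ (Fin (Module.finrank ℝ U)) := toEuclidean
  let e : U ≃L[ℝ] U :=
    (LinearEquiv.ofInjectiveEndo (T : U →ₗ[ℝ] U) hT).toContinuousLinearEquiv
  have he : ∀ x, T (e.symm x) = x := fun x => e.apply_symm_apply x
  have hM0 : 0 ≤ M := (norm_nonneg _).trans (hM 0)
  obtain ⟨y, hy⟩ := exists_eq_zero_of_norm_sub_le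
    (g := fun y => J (g (e.symm (J.symm y)) - c)) (by fun_prop)
    (M := ‖(J : U →L[ℝ] EuclideanSpace ℝ (Fin (Module.finrank ℝ U)))‖ * (M + ‖c‖)) (by
      intro y
      have h1 : J (g (e.symm (J.symm y)) - c) - y
          = (J : U →L[ℝ] _) ((g (e.symm (J.symm y)) - T (e.symm (J.symm y))) - c) := by
        simp [he]
        abel
      rw [h1]
      refine (ContinuousLinearMap.le_opNorm _ _).trans
        (mul_le_mul_of_nonneg_left ?_ (norm_nonneg _))
      exact (norm_sub_le _ _).trans (add_le_add_left (hM _) _))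
  exact ⟨_, sub_eq_zero.1 ((map_eq_zero_iff J J.injective).1 hy)⟩

theorem le_add_fderiv_add_sq {E : Type*} [NormedAddCommGroup E] [NormedSpace ℝ E] {Φ : E → ℝ}
    (hΦ : Differentiable ℝ Φ) {L : ℝ} (hL : ∀ x y, ‖fderiv ℝ Φ x - fderiv ℝ Φ y‖ ≤ L * ‖x - y‖)
    (hL0 : 0 ≤ L) (z w : E) : Φ (z + w) ≤ Φ z + fderiv ℝ Φ z w + L * ‖w‖ ^ 2 := by
  have h := Convex.norm_image_sub_le_of_norm_hasFDerivWithin_le' (f := Φ) (φ := fderiv ℝ Φ z)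
    (C := L * ‖w‖) (s := segment ℝ z (z + w))
    (f' := fderiv ℝ Φ) (fun x _ => (hΦ x).hasFDerivAt.hasFDerivWithinAt)
    (fun x hx => (hL x z).trans (mul_le_mul_of_nonneg_left (by
      obtain ⟨t, ht, rfl⟩ := (segment_eq_image' ℝ z (z + w)) ▸ hx
      simp only [add_sub_cancel_left, norm_smul, Real.norm_of_nonneg ht.1]
      exact mul_le_of_le_one_left (norm_nonneg _) ht.2) hL0))
    (convex_segment _ _) (left_mem_segment _ _ _) (right_mem_segment _ _ _)
  rw [add_sub_cancel_left, Real.norm_eq_abs] at h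
  have := (abs_le.1 h).2
  nlinarith

theorem exists_almost_critical_inner {E U : Type*} [NormedAddCommGroup E]
    [InnerProductSpace ℝ E] [FiniteDimensional ℝ E] [NormedAddCommGroup U]
    [NormedSpace ℝ U] [FiniteDimensional ℝ U] {Φ : E → ℝ} (hΦ : ContDiff ℝ 2 Φ) {L : ℝ}
    (hL : ∀ x y, ‖fderiv ℝ Φ x - fderiv ℝ Φ y‖ ≤ L * ‖x - y‖)
    (ι : U →L[ℝ] E) (π : E →L[ℝ] U) (hπι : Function.Injective (π.comp ι)) (c : U) {α β : ℝ}
    (hβ : ∀ v, Φ (ι v) ≤ β) (hα : ∀ z, π z = c → α ≤ Φ z) {η : ℝ} (hη : 0 < η) :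
    ∃ z, α ≤ Φ z ∧ ‖fderiv ℝ Φ z‖ < η := by
  by_contra! hcrit
  wlog hL0 : 0 ≤ L generalizing L
  · exact this (L := |L|) (fun x y => (hL x y).trans
      (mul_le_mul_of_nonneg_right (le_abs_self L) (norm_nonneg _))) (abs_nonneg L)
  set X : E → E := fun z => (InnerProductSpace.toDual ℝ E).symm (fderiv ℝ Φ z) with hX
  have hXd : ContDiff ℝ 1 X :=
    (InnerProductSpace.toDual ℝ E).symm.contDiff.comp (hΦ.fderiv_right (by norm_num))
  have hXn : ∀ z, ‖X z‖ = ‖fderiv ℝ Φ z‖ := fun z => LinearIsometryEquiv.norm_map _ _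
  have hXX : ∀ z, fderiv ℝ Φ z (X z) = ‖X z‖ ^ 2 := by
    intro z
    rw [← real_inner_self_eq_norm_sq, hX, InnerProductSpace.toDual_symm_apply]
  set h : ℝ := 1 / (2 * (L + 1)) with hh
  have hh0 : 0 < h := by positivity
  have hLh : L * h ≤ 1 / 2 := by
    rw [hh, mul_one_div, div_le_iff₀ (by positivity)]
    linarith
  set S : E → E := fun z => z + (-(h / (1 + ‖X z‖ ^ 2))) • X z with hS
  have hSd : ContDiff ℝ 1 S := by
    refine contDiff_id.add (ContDiff.smul ?_ hXd)
    exact (contDiff_const.div (contDiff_const.add (hXd.norm_sq ℝ))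
      (fun z => by positivity)).neg
  have hSn : ∀ z, ‖S z - z‖ ≤ h := by
    intro z
    have h1 : 0 < 1 + ‖X z‖ ^ 2 := by positivity
    rw [hS]
    simp only [add_sub_cancel_left, norm_smul, norm_neg]
    rw [Real.norm_of_nonneg (by positivity), div_mul_eq_mul_div, div_le_iff₀ h1]
    nlinarith [sq_nonneg (‖X z‖ - 1)]
  have hSΦ : ∀ z, Φ (S z) ≤ Φ z - h / 2 * (‖X z‖ ^ 2 / (1 + ‖X z‖ ^ 2)) := by
    intro z
    have h1 : 0 < 1 + ‖X z‖ ^ 2 := by positivity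
    refine (le_add_fderiv_add_sq (hΦ.differentiable (by norm_num)) hL hL0 _ _).trans ?_
    rw [map_smul, hXX, norm_smul, norm_neg, Real.norm_of_nonneg (by positivity), smul_eq_mul]
    set s := h / (1 + ‖X z‖ ^ 2) with hs
    have hs0 : 0 < s := by positivity
    have hsh : s ≤ h := div_le_self hh0.le (by nlinarith [sq_nonneg ‖X z‖])
    have hLs : L * s ≤ 1 / 2 := (mul_le_mul_of_nonneg_left hsh hL0).trans hLh
    have h2 : h / 2 * (‖X z‖ ^ 2 / (1 + ‖X z‖ ^ 2)) = s * ‖X z‖ ^ 2 / 2 := by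
      rw [hs]; ring
    rw [h2]
    have h3 : 0 ≤ s * ‖X z‖ ^ 2 := by positivity
    nlinarith [mul_le_mul_of_nonneg_right hLs h3]
  set d : ℝ := h / 2 * (η ^ 2 / (1 + η ^ 2)) with hd
  have hd0 : 0 < d := by positivity
  have hSmono : ∀ z, Φ (S z) ≤ Φ z := fun z =>
    (hSΦ z).trans (sub_le_self _ (by positivity))
  have hSdec : ∀ z, α ≤ Φ z → Φ (S z) ≤ Φ z - d := by
    intro z hz
    refine (hSΦ z).trans (sub_le_sub_left ?_ _)
    have h4 : η ≤ ‖X z‖ := by rw [hXn]; exact hcrit z hz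
    refine mul_le_mul_of_nonneg_left ?_ (by positivity)
    rw [div_le_div_iff₀ (by positivity) (by positivity)]
    nlinarith [mul_self_le_mul_self hη.le h4]
  have hiter : ∀ m : ℕ, ∀ z, (α ≤ Φ (S^[m] z) → Φ (S^[m] z) ≤ Φ z - m * d) ∧
      ‖S^[m] z - z‖ ≤ m * h := by
    intro m
    induction m with
    | zero => intro z; simp
    | succ m ih =>
      intro z
      rw [Function.iterate_succ_apply']
      refine ⟨fun hα' => ?_, ?_⟩
      · have h5 := hα'.trans (hSmono _)
        have h6 := hSdec _ h5
        have h7 := (ih z).1 h5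
        push_cast
        linarith
      · have h8 := norm_sub_le_norm_sub_add_norm_sub (S (S^[m] z)) (S^[m] z) z
        have h9 := hSn (S^[m] z)
        have h10 := (ih z).2
        push_cast
        linarith
  have hSmd : ∀ m, ContDiff ℝ 1 S^[m] := by
    intro m
    induction m with
    | zero => exact contDiff_id
    | succ m ih => exact ih.comp hSd
  obtain ⟨m, hm⟩ := exists_nat_gt ((β - α) / d)
  rw [div_lt_iff₀ hd0] at hm
  obtain ⟨v, hv⟩ := exists_eq_of_norm_sub_linear_le (g := fun v => π (S^[m] (ι v)))
    (π.contDiff.comp ((hSmd m).comp ι.contDiff)) hπι (M := ‖π‖ * (m * h)) (by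
      intro v
      rw [ContinuousLinearMap.comp_apply, ← map_sub]
      exact (π.le_opNorm _).trans (mul_le_mul_of_nonneg_left (hiter m _).2 (norm_nonneg _))) c
  have h1 := hα _ hv
  have h2 := (hiter m _).1 h1
  have h3 := hβ v
  linarith

/-- A linking theorem: a function with Lipschitz derivative which is bounded above by `β` on the
range of `ι` and below by `α` on a fibre of a linear map `π` complementary to it has almost
critical points above the level `α`. -/
theorem exists_almost_critical {E U : Type*} [NormedAddCommGroup E]
    [NormedSpace ℝ E] [FiniteDimensional ℝ E] [NormedAddCommGroup U]
    [NormedSpace ℝ U] [FiniteDimensional ℝ U] {Φ : E → ℝ} (hΦ : ContDiff ℝ 2 Φ) {L : ℝ}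
    (hL : ∀ x y, ‖fderiv ℝ Φ x - fderiv ℝ Φ y‖ ≤ L * ‖x - y‖)
    (ι : U →L[ℝ] E) (π : E →L[ℝ] U) (hπι : Function.Injective (π.comp ι)) (c : U) {α β : ℝ}
    (hβ : ∀ v, Φ (ι v) ≤ β) (hα : ∀ z, π z = c → α ≤ Φ z) {η : ℝ} (hη : 0 < η) :
    ∃ z, α ≤ Φ z ∧ ‖fderiv ℝ Φ z‖ < η := by
  let J : E ≃L[ℝ] EuclideanSpace ℝ (Fin (Module.finrank ℝ E)) := toEuclidean
  let A : EuclideanSpace ℝ (Fin (Module.finrank ℝ E)) →L[ℝ] E := J.symm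
  have hd : ∀ y, fderiv ℝ (fun y => Φ (A y)) y = (fderiv ℝ Φ (A y)).comp A := fun y =>
    (((hΦ.differentiable (by norm_num)) (A y)).hasFDerivAt.comp y A.hasFDerivAt).fderiv
  have hL0 : 0 ≤ |L| := abs_nonneg L
  obtain ⟨y, hy, hyη⟩ := exists_almost_critical_inner (Φ := fun y => Φ (A y))
    (hΦ.comp A.contDiff) (L := |L| * ‖A‖ * ‖A‖) (by
      intro x y
      rw [hd, hd, ← ContinuousLinearMap.sub_comp]
      refine (ContinuousLinearMap.opNorm_comp_le _ _).trans ?_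
      have h1 : ‖fderiv ℝ Φ (A x) - fderiv ℝ Φ (A y)‖ ≤ |L| * (‖A‖ * ‖x - y‖) :=
        (hL _ _).trans (mul_le_mul (le_abs_self L)
          (by rw [← map_sub]; exact A.le_opNorm _) (norm_nonneg _) hL0)
      calc _ ≤ |L| * (‖A‖ * ‖x - y‖) * ‖A‖ := mul_le_mul_of_nonneg_right h1 (norm_nonneg _)
        _ = _ := by ring)
    ((J : E →L[ℝ] _).comp ι) (π.comp A)
    (by
      have : (π.comp A).comp ((J : E →L[ℝ] _).comp ι) = π.comp ι := by
        ext v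
        simp [A]
      rw [this]
      exact hπι) c (α := α) (β := β)
    (by intro v; simpa [A] using hβ v) (fun z hz => hα _ hz)
    (η := η / (‖(J : E →L[ℝ] EuclideanSpace ℝ (Fin (Module.finrank ℝ E)))‖ + 1)) (by positivity)
  refine ⟨A y, hy, ?_⟩
  rw [lt_div_iff₀ (by positivity)] at hyη
  have h2 : fderiv ℝ Φ (A y) = (fderiv ℝ (fun y => Φ (A y)) y).comp (J : E →L[ℝ] _) := by
    rw [hd]
    ext v
    simp [A]
  rw [h2]
  refine (ContinuousLinearMap.opNorm_comp_le _ _).trans_lt (lt_of_le_of_lt ?_ hyη)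
  exact mul_le_mul_of_nonneg_left (by linarith) (norm_nonneg _)

/-- Twice continuously differentiable functions with Lipschitz derivative. -/
def HasLipschitzFDeriv {E : Type*} [NormedAddCommGroup E] [NormedSpace ℝ E] (Φ : E → ℝ) : Prop :=
  ContDiff ℝ 2 Φ ∧ ∃ L, ∀ x y, ‖fderiv ℝ Φ x - fderiv ℝ Φ y‖ ≤ L * ‖x - y‖

namespace HasLipschitzFDeriv

variable {E F V : Type*} [NormedAddCommGroup E] [NormedSpace ℝ E] [NormedAddCommGroup F]
  [NormedSpace ℝ F] [NormedAddCommGroup V] [InnerProductSpace ℝ V]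

theorem differentiable {Φ : E → ℝ} (hΦ : HasLipschitzFDeriv Φ) : Differentiable ℝ Φ :=
  hΦ.1.differentiable (by norm_num)

theorem add {Φ Ψ : E → ℝ} (hΦ : HasLipschitzFDeriv Φ) (hΨ : HasLipschitzFDeriv Ψ) :
    HasLipschitzFDeriv (fun x => Φ x + Ψ x) := by
  obtain ⟨h1, L, hL⟩ := id hΦ
  obtain ⟨h2, M, hM⟩ := id hΨ
  refine ⟨h1.add h2, L + M, fun x y => ?_⟩
  rw [fderiv_fun_add (hΦ.differentiable x) (hΨ.differentiable x),
    fderiv_fun_add (hΦ.differentiable y) (hΨ.differentiable y), add_sub_add_comm, add_mul]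
  exact (norm_add_le _ _).trans (add_le_add (hL x y) (hM x y))

theorem const_mul {Φ : E → ℝ} (hΦ : HasLipschitzFDeriv Φ) (c : ℝ) :
    HasLipschitzFDeriv (fun x => c * Φ x) := by
  obtain ⟨h1, L, hL⟩ := id hΦ
  refine ⟨contDiff_const.mul h1, |c| * L, fun x y => ?_⟩
  rw [fderiv_const_mul (hΦ.differentiable x), fderiv_const_mul (hΦ.differentiable y),
    ← smul_sub, norm_smul, mul_assoc]
  exact mul_le_mul_of_nonneg_left (hL x y) (norm_nonneg _)

theorem sum {Φ : ℕ → E → ℝ} {s : Finset ℕ} (hΦ : ∀ k ∈ s, HasLipschitzFDeriv (Φ k)) :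
    HasLipschitzFDeriv (fun x => ∑ k ∈ s, Φ k x) := by
  induction s using Finset.induction_on with
  | empty => exact ⟨by simpa using contDiff_const, 0, by simp⟩
  | insert a s ha ih =>
    simp only [Finset.sum_insert ha]
    exact (hΦ a (by simp)).add (ih fun k hk => hΦ k (by simp [hk]))

theorem comp {Φ : F → ℝ} (hΦ : HasLipschitzFDeriv Φ) (A : E →L[ℝ] F) :
    HasLipschitzFDeriv (fun x => Φ (A x)) := by
  obtain ⟨h1, L, hL⟩ := id hΦ
  have hd : ∀ y, fderiv ℝ (fun y => Φ (A y)) y = (fderiv ℝ Φ (A y)).comp A := fun y =>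
    ((hΦ.differentiable (A y)).hasFDerivAt.comp y A.hasFDerivAt).fderiv
  refine ⟨h1.comp A.contDiff, |L| * ‖A‖ * ‖A‖, fun x y => ?_⟩
  rw [hd, hd, ← ContinuousLinearMap.sub_comp]
  refine (ContinuousLinearMap.opNorm_comp_le _ _).trans ?_
  have h1 : ‖fderiv ℝ Φ (A x) - fderiv ℝ Φ (A y)‖ ≤ |L| * (‖A‖ * ‖x - y‖) :=
    (hL _ _).trans (mul_le_mul (le_abs_self L)
      (by rw [← map_sub]; exact A.le_opNorm _) (norm_nonneg _) (abs_nonneg L))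
  calc _ ≤ |L| * (‖A‖ * ‖x - y‖) * ‖A‖ := mul_le_mul_of_nonneg_right h1 (norm_nonneg _)
    _ = _ := by ring

theorem inner (A B : E →L[ℝ] V) : HasLipschitzFDeriv (fun x => inner ℝ (A x) (B x)) := by
  refine ⟨A.contDiff.inner ℝ B.contDiff, 2 * (‖A‖ * ‖B‖), fun x y => ?_⟩
  have hd : ∀ x v, fderiv ℝ (fun x => Inner.inner ℝ (A x) (B x)) x v
      = Inner.inner ℝ (A x) (B v) + Inner.inner ℝ (A v) (B x) := by
    intro x v
    rw [fderiv_inner_apply ℝ A.differentiableAt B.differentiableAt]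
    simp
  refine ContinuousLinearMap.opNorm_le_bound _ (by positivity) fun v => ?_
  rw [sub_apply, hd, hd]
  have h1 : Inner.inner ℝ (A x) (B v) + Inner.inner ℝ (A v) (B x)
      - (Inner.inner ℝ (A y) (B v) + Inner.inner ℝ (A v) (B y))
      = Inner.inner ℝ (A (x - y)) (B v) + Inner.inner ℝ (A v) (B (x - y)) := by
    simp only [map_sub, inner_sub_left, inner_sub_right]
    ring
  have h2 : ∀ u v, ‖Inner.inner ℝ (A u) (B v)‖ ≤ ‖A‖ * ‖B‖ * ‖u‖ * ‖v‖ := by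
    intro u v
    calc _ ≤ ‖A u‖ * ‖B v‖ := norm_inner_le_norm _ _
      _ ≤ (‖A‖ * ‖u‖) * (‖B‖ * ‖v‖) :=
        mul_le_mul (A.le_opNorm _) (B.le_opNorm _) (norm_nonneg _) (by positivity)
      _ = _ := by ring
  rw [h1]
  refine (norm_add_le _ _).trans ((add_le_add (h2 _ _) (h2 _ _)).trans (le_of_eq ?_))
  ring

end HasLipschitzFDeriv

theorem norm_sq_le_card_mul_sum_sub {V : Type*} [NormedAddCommGroup V] {q : ℕ → V} {N : ℕ}
    (hq : q N = 0) {j : ℕ} (hj : j ≤ N) :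
    ‖q j‖ ^ 2 ≤ N * ∑ k ∈ Finset.range N, ‖q (k + 1) - q k‖ ^ 2 := by
  have h1 : q j = -∑ k ∈ Finset.Ico j N, (q (k + 1) - q k) := by
    rw [Finset.sum_Ico_sub _ hj, hq]
    simp
  have h2 : ‖q j‖ ≤ ∑ k ∈ Finset.range N, ‖q (k + 1) - q k‖ := by
    rw [h1, norm_neg]
    refine (norm_sum_le _ _).trans (Finset.sum_le_sum_of_subset_of_nonneg ?_ ?_)
    · intro k hk
      simp at hk ⊢
      exact hk.2
    · intros
      positivity
  have h3 := sq_sum_le_card_mul_sum_sq (s := Finset.range N) (f := fun k => ‖q (k + 1) - q k‖)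
  rw [Finset.card_range] at h3
  exact (pow_le_pow_left₀ (norm_nonneg _) h2 2).trans h3

/-- The discrete action of a sequence of positions and momenta. -/
noncomputable def discreteAction {V : Type*} [NormedAddCommGroup V] [InnerProductSpace ℝ V]
    (N : ℕ) (F : ℕ → V × V → ℝ) (h B : ℝ) (q p : ℕ → V) : ℝ :=
  ∑ k ∈ Finset.range N, (inner ℝ (p k) (q (k + 1) - q k) + -h * F k (q (k + 1), p k))
    + B / 2 * inner ℝ (q 0) (q 0)

theorem discreteAction_le {V : Type*} [NormedAddCommGroup V] [InnerProductSpace ℝ V]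
    {N : ℕ} {F : ℕ → V × V → ℝ} {h B M : ℝ} (hh : 0 ≤ h) (hB : 0 ≤ B) (hM : ∀ k x, -M ≤ F k x)
    {q p : ℕ → V} (hq : q N = 0)
    (hp : ∀ k < N, p k = -((B * N / 2) • (q (k + 1) - q k))) :
    discreteAction N F h B q p ≤ N * h * M := by
  have h1 := norm_sq_le_card_mul_sum_sub hq (Nat.zero_le N)
  have h2 : ∑ k ∈ Finset.range N, (inner ℝ (p k) (q (k + 1) - q k) + -h * F k (q (k + 1), p k))
      ≤ ∑ k ∈ Finset.range N, (-(B * N / 2) * ‖q (k + 1) - q k‖ ^ 2 + h * M) := by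
    refine Finset.sum_le_sum fun k hk => add_le_add (le_of_eq ?_) ?_
    · rw [hp k (Finset.mem_range.1 hk), inner_neg_left, real_inner_smul_left,
        real_inner_self_eq_norm_sq]
      ring
    · nlinarith [hM k (q (k + 1), p k)]
  have h3 : ∑ k ∈ Finset.range N, (-(B * N / 2) * ‖q (k + 1) - q k‖ ^ 2 + h * M)
      = -(B * N / 2) * ∑ k ∈ Finset.range N, ‖q (k + 1) - q k‖ ^ 2 + N * (h * M) := by
    rw [Finset.sum_add_distrib, ← Finset.mul_sum, Finset.sum_const, Finset.card_range,
      nsmul_eq_mul]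
  rw [discreteAction, real_inner_self_eq_norm_sq]
  nlinarith [mul_le_mul_of_nonneg_left h1 (by positivity : 0 ≤ B / 2)]

theorem le_discreteAction {V : Type*} [NormedAddCommGroup V] [InnerProductSpace ℝ V]
    {N : ℕ} {F : ℕ → V × V → ℝ} {h B a κ : ℝ} (hh : 0 ≤ h) (hB : 0 < B) (hκ : 0 ≤ κ) {w : V}
    (hF : ∀ k q p, a - κ * (‖q‖ ^ 2 + ‖p - w‖ ^ 2) ≤ -F k (q, p)) (hκh : 2 * κ * (N * h) ≤ 1)
    {q p : ℕ → V} (hq : q N = 0) (hp : ∀ k < N, p k = w + (N : ℝ) • (q (k + 1) - q k)) :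
    N * h * a - ‖w‖ ^ 2 / (2 * B) ≤ discreteAction N F h B q p := by
  set S := ∑ k ∈ Finset.range N, ‖q (k + 1) - q k‖ ^ 2 with hS
  have hS0 : 0 ≤ S := Finset.sum_nonneg fun _ _ => by positivity
  have h2 : ∑ k ∈ Finset.range N, (inner ℝ w (q (k + 1) - q k) + N * ‖q (k + 1) - q k‖ ^ 2
        + (h * a - h * κ * (N * S) - h * κ * N ^ 2 * ‖q (k + 1) - q k‖ ^ 2))
      ≤ ∑ k ∈ Finset.range N, (inner ℝ (p k) (q (k + 1) - q k) + -h * F k (q (k + 1), p k)) := by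
    refine Finset.sum_le_sum fun k hk => add_le_add (le_of_eq ?_) ?_
    · rw [hp k (Finset.mem_range.1 hk), inner_add_left, real_inner_smul_left,
        real_inner_self_eq_norm_sq]
    · have h3 := hF k (q (k + 1)) (p k)
      have h4 := norm_sq_le_card_mul_sum_sub hq (Finset.mem_range.1 hk)
      rw [hp k (Finset.mem_range.1 hk), add_sub_cancel_left, norm_smul, Real.norm_natCast,
        mul_pow] at h3
      rw [hp k (Finset.mem_range.1 hk)]
      have h5 := mul_le_mul_of_nonneg_left h3 hh
      have h6 := mul_le_mul_of_nonneg_left h4 (mul_nonneg hh hκ)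
      rw [← hS] at h6
      linarith
  rw [Finset.sum_add_distrib, Finset.sum_add_distrib, Finset.sum_sub_distrib, ← Finset.mul_sum,
    ← Finset.mul_sum, ← inner_sum, Finset.sum_range_sub, hq, zero_sub, inner_neg_right, ← hS] at h2
  simp only [Finset.sum_const, Finset.card_range, nsmul_eq_mul] at h2
  rw [discreteAction]
  have h7 : 0 ≤ B / 2 * ‖q 0 - B⁻¹ • w‖ ^ 2 := by positivity
  have h8 : B / 2 * ‖q 0 - B⁻¹ • w‖ ^ 2
      = B / 2 * inner ℝ (q 0) (q 0) - inner ℝ w (q 0) + ‖w‖ ^ 2 / (2 * B) := by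
    rw [norm_sub_sq_real, real_inner_smul_right, norm_smul, real_inner_self_eq_norm_sq,
      real_inner_comm, Real.norm_of_nonneg (by positivity)]
    field_simp
  have h9 := mul_le_mul_of_nonneg_left hκh (mul_nonneg (Nat.cast_nonneg N) hS0)
  nlinarith

/-- The discrete action functional has almost critical points at a positive level, i.e. there are
discrete trajectories solving Hamilton's equations up to an arbitrarily small error. -/
theorem exists_almost_hamiltonian_sequence {V : Type*} [NormedAddCommGroup V]
    [InnerProductSpace ℝ V] [FiniteDimensional ℝ V] {N : ℕ} {F : ℕ → V × V → ℝ}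
    (hFd : ∀ k, HasLipschitzFDeriv (F k)) {h B a κ M : ℝ} (hh : 0 ≤ h) (hB : 0 < B) (hκ : 0 ≤ κ)
    {w : V} (hF : ∀ k q p, a - κ * (‖q‖ ^ 2 + ‖p - w‖ ^ 2) ≤ -F k (q, p))
    (hκh : 2 * κ * (N * h) ≤ 1) (hM : ∀ k x, -M ≤ F k x) {η : ℝ} (hη : 0 < η) :
    ∃ q p : ℕ → V, q N = 0 ∧ N * h * a - ‖w‖ ^ 2 / (2 * B) ≤ discreteAction N F h B q p ∧
      (∀ k < N, ∀ v, |inner ℝ v (q (k + 1) - q k)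
        - h * fderiv ℝ (F k) (q (k + 1), p k) (0, v)| ≤ η * ‖v‖) ∧
      (∀ k, k + 1 < N → ∀ v, |inner ℝ v (p (k + 1) - p k)
        + h * fderiv ℝ (F k) (q (k + 1), p k) (v, 0)| ≤ η * ‖v‖) ∧
      (0 < N → ∀ v, |inner ℝ v (p 0 - B • q 0)| ≤ η * ‖v‖) := by
  let c : ℕ → (Fin N → V) →L[ℝ] V := fun k =>
    if hk : k < N then ContinuousLinearMap.proj ⟨k, hk⟩ else 0
  have hcN : ∀ v, c N v = 0 := by intro v; simp [c]
  have hc : ∀ k (hk : k < N) v, c k v = v ⟨k, hk⟩ := by intro k hk v; simp [c, hk]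
  have hcs : ∀ (j : Fin N) k v, c k (Pi.single j v) = if k = j then v else 0 := by
    intro j k v
    by_cases hk : k < N
    · rw [hc k hk, Pi.single_apply]
      simp [Fin.ext_iff]
    · have : k ≠ j := by omega
      simp [c, hk, this]
  let D : (Fin N → V) →L[ℝ] (Fin N → V) := ContinuousLinearMap.pi fun k => c (k + 1) - c k
  have hD : ∀ v k (hk : k < N), D v ⟨k, hk⟩ = c (k + 1) v - c k v := by
    intro v k hk; simp [D]
  have hDinj : ∀ v, D v = 0 → v = 0 := by
    intro v hv
    ext1 ⟨k, hk⟩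
    have h1 := norm_sq_le_card_mul_sum_sub (q := fun k => c k v) (hcN v) hk.le
    rw [Finset.sum_eq_zero (fun k hk => by
      rw [← hD v k (Finset.mem_range.1 hk), hv]; simp), mul_zero] at h1
    rw [← hc k hk v]
    simpa using h1
  let Q : ℕ → (Fin N → V) × (Fin N → V) →L[ℝ] V := fun k =>
    (c k).comp (ContinuousLinearMap.fst ℝ _ _)
  let P : ℕ → (Fin N → V) × (Fin N → V) →L[ℝ] V := fun k =>
    (c k).comp (ContinuousLinearMap.snd ℝ _ _)
  set Φ : (Fin N → V) × (Fin N → V) → ℝ := fun z =>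
    discreteAction N F h B (fun k => Q k z) (fun k => P k z) with hΦ
  have hΦd : HasLipschitzFDeriv Φ := by
    refine HasLipschitzFDeriv.add (HasLipschitzFDeriv.sum fun k _ =>
      HasLipschitzFDeriv.add ?_ (HasLipschitzFDeriv.const_mul ?_ _))
      (HasLipschitzFDeriv.const_mul (HasLipschitzFDeriv.inner _ _) _)
    · exact HasLipschitzFDeriv.inner (P k) (Q (k + 1) - Q k)
    · exact (hFd k).comp ((Q (k + 1)).prod (P k))
  have hder : ∀ z v, fderiv ℝ Φ z v = ∑ k ∈ Finset.range N,
      (inner ℝ (P k z) (Q (k + 1) v - Q k v) + inner ℝ (P k v) (Q (k + 1) z - Q k z)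
        + -h * fderiv ℝ (F k) (Q (k + 1) z, P k z) (Q (k + 1) v, P k v))
      + B * inner ℝ (Q 0 z) (Q 0 v) := by
    intro z v
    have h1 : ∀ k, HasFDerivAt (fun z => inner ℝ (P k z) (Q (k + 1) z - Q k z)
        + -h * F k (Q (k + 1) z, P k z)) _ z := fun k =>
      ((P k).hasFDerivAt.inner ℝ (Q (k + 1) - Q k).hasFDerivAt).add
        ((((hFd k).differentiable _).hasFDerivAt.comp z
          ((Q (k + 1)).prod (P k)).hasFDerivAt).const_mul (-h))
    have h2 := (HasFDerivAt.fun_sum (u := Finset.range N) fun k _ => h1 k).add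
      (((Q 0).hasFDerivAt.inner ℝ (Q 0).hasFDerivAt).const_mul (B / 2))
    have h3 := h2.fderiv
    have h4 : fderiv ℝ Φ z v = _ := congrArg (fun A => A v) h3
    rw [h4]
    simp [real_inner_comm]
    ring
  obtain ⟨L, hL⟩ := hΦd.2
  obtain ⟨z, hz, hzη⟩ := exists_almost_critical hΦd.1 hL
    (ι := (ContinuousLinearMap.id ℝ _).prod (-((B * N / 2) • D)))
    (π := ContinuousLinearMap.snd ℝ _ _ - (N : ℝ) • D.comp (ContinuousLinearMap.fst ℝ _ _))
    (by
      rw [injective_iff_map_eq_zero]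
      intro v hv
      apply hDinj
      have h1 : (B * N / 2 + N : ℝ) • D v = 0 := by
        rw [add_smul, ← neg_eq_zero, ← hv]
        simp
        abel
      rcases smul_eq_zero.1 h1 with h2 | h2
      · have hN : (N : ℝ) = 0 := by nlinarith [(Nat.cast_nonneg N : (0 : ℝ) ≤ N)]
        ext1 ⟨k, hk⟩
        simp only [Nat.cast_eq_zero] at hN
        omega
      · exact h2) (fun _ => w)
    (α := N * h * a - ‖w‖ ^ 2 / (2 * B)) (β := N * h * M)
    (by
      intro v
      refine discreteAction_le hh hB.le hM (by simp [Q, hcN]) ?_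
      intro k hk
      simp [P, Q, hc k hk, hD])
    (by
      intro z hz
      refine le_discreteAction hh hB hκ hF hκh (by simp [Q, hcN]) ?_
      intro k hk
      have h1 := congrFun hz ⟨k, hk⟩
      simp [hD] at h1
      simp [P, Q, hc k hk, ← h1]) hη
  refine ⟨fun k => Q k z, fun k => P k z, by simp [Q, hcN], hz, ?_, ?_, ?_⟩
  · intro k hk v
    have h1 := (fderiv ℝ Φ z).le_of_opNorm_le hzη.le (0, Pi.single ⟨k, hk⟩ v)
    have hP : ∀ k', P k' (0, Pi.single ⟨k, hk⟩ v) = if k' = k then v else 0 :=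
      fun k' => by simp [P, hcs]
    have hQ : ∀ k', Q k' (0, Pi.single ⟨k, hk⟩ v) = 0 := fun k' => by simp [Q]
    rw [hder, Finset.sum_eq_single k (fun k' _ hne => by simp [hP, hQ, hne, Prod.mk_zero_zero])
      (fun h => absurd (Finset.mem_range.2 hk) h)] at h1
    simpa [hP, hQ, Prod.norm_mk, Pi.norm_single, ← sub_eq_add_neg] using h1
  · intro k hk v
    have h1 := (fderiv ℝ Φ z).le_of_opNorm_le hzη.le (Pi.single ⟨k + 1, hk⟩ v, 0)
    have hP : ∀ k', P k' (Pi.single ⟨k + 1, hk⟩ v, 0) = 0 := fun k' => by simp [P]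
    have hQ : ∀ k', Q k' (Pi.single ⟨k + 1, hk⟩ v, 0) = if k' = k + 1 then v else 0 :=
      fun k' => by simp [Q, hcs]
    rw [hder, Finset.sum_eq_add_of_mem k (k + 1) (by simp; omega) (by simp [hk]) (by simp)
      (fun k' _ hne => by
        simp [hP, hQ, hne.1, hne.2, Prod.mk_zero_zero])] at h1
    simp only [hP, hQ, Prod.norm_mk, Pi.norm_single, norm_zero, max_eq_left, norm_nonneg,
      Real.norm_eq_abs] at h1
    refine le_trans (le_of_eq ?_) h1
    rw [← abs_neg]
    congr 1
    simp [inner_sub_right, real_inner_comm, Prod.mk_zero_zero]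
    ring
  · intro hN v
    have h1 := (fderiv ℝ Φ z).le_of_opNorm_le hzη.le (Pi.single ⟨0, hN⟩ v, 0)
    have hP : ∀ k', P k' (Pi.single ⟨0, hN⟩ v, 0) = 0 := fun k' => by simp [P]
    have hQ : ∀ k', Q k' (Pi.single ⟨0, hN⟩ v, 0) = if k' = 0 then v else 0 :=
      fun k' => by simp [Q, hcs]
    rw [hder, Finset.sum_eq_single 0 (fun k' _ hne => by
      simp [hP, hQ, hne, Prod.mk_zero_zero]) (by simp [hN.ne'])] at h1
    simp only [hP, hQ, Prod.norm_mk, Pi.norm_single, norm_zero, max_eq_left, norm_nonneg,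
      Real.norm_eq_abs] at h1
    refine le_trans (le_of_eq ?_) h1
    rw [← abs_neg]
    congr 1
    simp [inner_sub_right, real_inner_smul_right, real_inner_comm, Prod.mk_zero_zero]
    ring

theorem exists_lipschitz_bound_fderiv_slice {E : Type*} [NormedAddCommGroup E] [NormedSpace ℝ E]
    [FiniteDimensional ℝ E] {G : ℝ × E → ℝ} (hG : ContDiff ℝ 2 G) {K : Set E} (hK : IsCompact K)
    (hGK : ∀ t ∈ Set.Icc (0 : ℝ) 1, (Function.support fun x => G (t, x)) ⊆ K) :
    (∀ t ∈ Set.Icc (0 : ℝ) 1, ∀ x ∉ K, fderiv ℝ (fun x => G (t, x)) x = 0) ∧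
    ∃ L M : ℝ, 0 ≤ L ∧ 0 ≤ M ∧
      (∀ t ∈ Set.Icc (0 : ℝ) 1, ∀ x, ‖fderiv ℝ (fun x => G (t, x)) x‖ ≤ M) ∧
      ∀ t ∈ Set.Icc (0 : ℝ) 1, ∀ s ∈ Set.Icc (0 : ℝ) 1, ∀ x y,
        ‖fderiv ℝ (fun x => G (t, x)) x - fderiv ℝ (fun x => G (s, x)) y‖
          ≤ L * (|t - s| + ‖x - y‖) := by
  have : ProperSpace E := FiniteDimensional.proper ℝ E
  set D : ℝ × E → E →L[ℝ] ℝ := fun z => (fderiv ℝ G z).comp (ContinuousLinearMap.inr ℝ ℝ E)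
    with hD
  have hDd : ContDiff ℝ 1 D := (hG.fderiv_right (by norm_num)).clm_comp contDiff_const
  have hGD : ∀ t x, fderiv ℝ (fun x => G (t, x)) x = D (t, x) := by
    intro t x
    exact (((hG.differentiable (by norm_num)) (t, x)).hasFDerivAt.comp x
      (hasFDerivAt_prodMk_right t x)).fderiv
  have hD0 : ∀ t ∈ Set.Icc (0 : ℝ) 1, ∀ x ∉ K, D (t, x) = 0 := by
    intro t ht x hx
    rw [← hGD]
    have h1 : (fun x => G (t, x)) =ᶠ[nhds x] fun _ => 0 := by
      filter_upwards [hK.isClosed.isOpen_compl.mem_nhds hx] with y hy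
      by_contra h
      exact hy (hGK t ht h)
    rw [h1.fderiv_eq]
    simp
  obtain ⟨R, hR⟩ := hK.isBounded.exists_norm_le
  obtain ⟨M, hM⟩ := (isCompact_Icc.prod hK).exists_bound_of_continuousOn
    hDd.continuous.continuousOn
  set C : Set (ℝ × E) := Set.Icc (0 : ℝ) 1 ×ˢ Metric.closedBall (0 : E) (R + 1) with hC
  obtain ⟨Λ, hΛ⟩ := (isCompact_Icc.prod (isCompact_closedBall (0 : E) (R + 1)
    )).exists_bound_of_continuousOn
    (hDd.continuous_fderiv (by norm_num)).continuousOn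
  have hCc : Convex ℝ C := (convex_Icc _ _).prod (convex_closedBall _ _)
  have hDM : ∀ t ∈ Set.Icc (0 : ℝ) 1, ∀ x, ‖D (t, x)‖ ≤ |M| := by
    intro t ht x
    by_cases hx : x ∈ K
    · exact (hM (t, x) ⟨ht, hx⟩).trans (le_abs_self _)
    · rw [hD0 t ht x hx, norm_zero]
      positivity
  have hnorm : ∀ (t s : ℝ) (x y : E), ‖(t, x) - (s, y)‖ ≤ |t - s| + ‖x - y‖ := by
    intro t s x y
    rw [Prod.mk_sub_mk, Prod.norm_mk]
    exact max_le_add_of_nonneg (norm_nonneg _) (norm_nonneg _)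
  have hfar : ∀ t ∈ Set.Icc (0 : ℝ) 1, ∀ s ∈ Set.Icc (0 : ℝ) 1, ∀ x y, R + 1 < ‖y‖ →
      ‖D (t, x) - D (s, y)‖ ≤ |M| * (|t - s| + ‖x - y‖) := by
    intro t ht s hs x y hy
    rw [hD0 s hs y (fun h => by linarith [hR y h]), sub_zero]
    by_cases hx : x ∈ K
    · refine (hDM t ht x).trans (le_mul_of_one_le_right (abs_nonneg _) ?_)
      have h1 := norm_le_norm_add_norm_sub x y
      have h2 := hR x hx
      have h3 := abs_nonneg (t - s)
      linarith
    · rw [hD0 t ht x hx, norm_zero]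
      positivity
  refine ⟨fun t ht x hx => by rw [hGD, hD0 t ht x hx], |Λ| + |M|, |M|, by positivity,
    by positivity, fun t ht x => by rw [hGD]; exact hDM t ht x, fun t ht s hs x y => ?_⟩
  rw [hGD, hGD, add_mul]
  have h0 : 0 ≤ |t - s| + ‖x - y‖ := by positivity
  have h1 : 0 ≤ |Λ| * (|t - s| + ‖x - y‖) := by positivity
  have h2 : 0 ≤ |M| * (|t - s| + ‖x - y‖) := by positivity
  rcases lt_or_ge (R + 1) ‖y‖ with hy | hy
  · linarith [hfar t ht s hs x y hy]
  rcases lt_or_ge (R + 1) ‖x‖ with hx | hx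
  · have := hfar s hs t ht y x hx
    rw [norm_sub_rev, abs_sub_comm, norm_sub_rev y] at this
    linarith
  · have h3 := hCc.norm_image_sub_le_of_norm_fderiv_le (𝕜 := ℝ) (f := D)
      (fun z _ => hDd.differentiable (by norm_num) z) (fun z hz => hΛ z hz)
      (x := (s, y)) (y := (t, x)) ⟨hs, by simpa using hy⟩ ⟨ht, by simpa using hx⟩
    have h4 : Λ * ‖(t, x) - (s, y)‖ ≤ |Λ| * (|t - s| + ‖x - y‖) :=
      mul_le_mul (le_abs_self _) (hnorm _ _ _ _) (norm_nonneg _) (abs_nonneg _)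
    linarith

theorem exists_trajectory_through {E : Type*} [NormedAddCommGroup E] [NormedSpace ℝ E]
    [CompleteSpace E] {X : ℝ → E → E} {L M : ℝ} (hL0 : 0 ≤ L) (hM0 : 0 ≤ M)
    (hM : ∀ t ∈ Set.Icc (0 : ℝ) 1, ∀ x, ‖X t x‖ ≤ M)
    (hL : ∀ t ∈ Set.Icc (0 : ℝ) 1, ∀ s ∈ Set.Icc (0 : ℝ) 1, ∀ x y,
      ‖X t x - X s y‖ ≤ L * (|t - s| + ‖x - y‖))
    {φ : ℝ × E → E} (hφ0 : ∀ x, φ (0, x) = x)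
    (hφ : ∀ x, ∀ t ∈ Set.Icc (0 : ℝ) 1, HasDerivAt (fun s => φ (s, x)) (X t (φ (t, x))) t)
    {t₁ : ℝ} (ht₁ : t₁ ∈ Set.Icc (0 : ℝ) 1) (y : E) : ∃ x, φ (t₁, x) = y := by
  have hsub : Set.Icc (0 : ℝ) t₁ ⊆ Set.Icc 0 1 := Set.Icc_subset_Icc_right ht₁.2
  have hlip : ∀ t ∈ Set.Icc (0 : ℝ) 1, LipschitzWith (NNReal.mk L hL0) (X t) := by
    intro t ht
    refine LipschitzWith.of_dist_le_mul fun x y => ?_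
    have := hL t ht t ht x y
    simp only [sub_self, abs_zero, zero_add] at this
    rw [dist_eq_norm, dist_eq_norm]
    exact this
  have hpl : IsPicardLindelof X (tmin := 0) (tmax := t₁) ⟨t₁, Set.right_mem_Icc.2 ht₁.1⟩ y
      (NNReal.mk M hM0) 0 (NNReal.mk M hM0) (NNReal.mk L hL0) := by
    refine ⟨fun t ht => (hlip t (hsub ht)).lipschitzOnWith, fun x _ => ?_,
      fun t ht x _ => hM t (hsub ht) x, ?_⟩
    · refine LipschitzOnWith.continuousOn (K := NNReal.mk L hL0) ?_
      refine LipschitzOnWith.of_dist_le_mul fun t ht s hs => ?_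
      have := hL t (hsub ht) s (hsub hs) x x
      simp only [sub_self, norm_zero, add_zero] at this
      rw [dist_eq_norm, Real.dist_eq]
      exact this
    · simp only [sub_self, sub_zero, NNReal.coe_zero, NNReal.coe_mk]
      rw [max_eq_right ht₁.1]
      exact mul_le_of_le_one_right hM0 ht₁.2
  obtain ⟨α, hα1, hα⟩ := hpl.exists_eq_forall_mem_Icc_hasDerivWithinAt₀
  refine ⟨α 0, ?_⟩
  have h := ODE_solution_unique_of_mem_Icc_right (v := X) (s := fun _ => Set.univ)
    (K := NNReal.mk L hL0) (f := fun s => φ (s, α 0)) (g := α) (a := 0) (b := t₁)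
    (fun t ht => (hlip t (hsub (Set.Ico_subset_Icc_self ht))).lipschitzOnWith)
    (fun t ht => (hφ (α 0) t (hsub ht)).continuousAt.continuousWithinAt)
    (fun t ht => (hφ (α 0) t (hsub (Set.Ico_subset_Icc_self ht))).hasDerivWithinAt)
    (fun _ _ => Set.mem_univ _)
    (fun t ht => (hα t ht).continuousWithinAt)
    (fun t ht => (hα t (Set.Ico_subset_Icc_self ht)).mono_of_mem_nhdsWithin
      (Icc_mem_nhdsGE_of_mem ht))
    (fun _ _ => Set.mem_univ _) (hφ0 _) (Set.right_mem_Icc.2 ht₁.1)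
  exact h.trans hα1

theorem norm_euler_sub_le {E : Type*} [NormedAddCommGroup E] [NormedSpace ℝ E]
    {X : ℝ → E → E} {L M : ℝ} (hL0 : 0 ≤ L) (hM0 : 0 ≤ M)
    (hM : ∀ t ∈ Set.Icc (0 : ℝ) 1, ∀ x, ‖X t x‖ ≤ M)
    (hL : ∀ t ∈ Set.Icc (0 : ℝ) 1, ∀ s ∈ Set.Icc (0 : ℝ) 1, ∀ x y,
      ‖X t x - X s y‖ ≤ L * (|t - s| + ‖x - y‖))
    {y : ℝ → E} (hy : ∀ t ∈ Set.Icc (0 : ℝ) 1, HasDerivAt y (X t (y t)) t)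
    {t₁ h η : ℝ} {m : ℕ} (ht₁ : 0 ≤ t₁) (hh : 0 ≤ h) (hη : 0 ≤ η) (hm : t₁ + m * h ≤ 1)
    {z ζ : ℕ → E} (hz0 : z 0 = y t₁) (hζ : ∀ k < m, ‖ζ k - z k‖ ≤ h * M + η)
    (hz : ∀ k < m, ‖z (k + 1) - z k - h • X (t₁ + k * h) (ζ k)‖ ≤ η) :
    ‖z m - y (t₁ + m * h)‖ ≤ m * (L * (1 + 2 * M) * h ^ 2 + (1 + h * L) * η) * (1 + h * L) ^ m := by
  have hyM : ∀ t ∈ Set.Icc (0 : ℝ) 1, ∀ s ∈ Set.Icc (0 : ℝ) 1, ‖y s - y t‖ ≤ M * ‖s - t‖ :=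
    fun t ht s hs => (convex_Icc (0 : ℝ) 1).norm_image_sub_le_of_norm_hasDerivWithin_le
      (fun t ht => (hy t ht).hasDerivWithinAt) (fun t ht => hM t ht _) ht hs
  induction m with
  | zero => simp [hz0]
  | succ m ih =>
    push_cast at hm
    have hmh : 0 ≤ (m : ℝ) * h := by positivity
    have ih := ih (by linarith) (fun k hk => hζ k (by omega)) (fun k hk => hz k (by omega))
    set s := t₁ + m * h with hs
    have hs1 : s ∈ Set.Icc (0 : ℝ) 1 := ⟨by positivity, by linarith⟩
    have hsh : s + h ∈ Set.Icc (0 : ℝ) 1 := ⟨by linarith [hs1.1], by linarith⟩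
    have hsub : Set.Icc s (s + h) ⊆ Set.Icc 0 1 := Set.Icc_subset_Icc hs1.1 hsh.2
    have h1 : ‖(y (s + h) - (s + h) • X s (y s)) - (y s - s • X s (y s))‖
        ≤ (L * (1 + M) * h) * ‖(s + h) - s‖ := by
      refine (convex_Icc s (s + h)).norm_image_sub_le_of_norm_hasDerivWithin_le
        (f := fun t => y t - t • X s (y s)) (f' := fun t => X t (y t) - (1 : ℝ) • X s (y s))
        (fun t ht => ((hy t (hsub ht)).sub
          ((hasDerivAt_id t).smul_const _)).hasDerivWithinAt)
        (fun t ht => ?_) (Set.left_mem_Icc.2 (by linarith)) (Set.right_mem_Icc.2 (by linarith))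
      rw [one_smul]
      refine (hL t (hsub ht) s hs1 _ _).trans ?_
      have h2 := hyM s hs1 t (hsub ht)
      have h3 : |t - s| ≤ h := by rw [abs_of_nonneg] <;> linarith [ht.1, ht.2]
      rw [Real.norm_eq_abs] at h2
      have h4 : |t - s| + ‖y t - y s‖ ≤ (1 + M) * h := by nlinarith [abs_nonneg (t - s)]
      calc _ ≤ L * ((1 + M) * h) := mul_le_mul_of_nonneg_left h4 hL0
        _ = _ := by ring
    rw [add_sub_cancel_left, Real.norm_of_nonneg hh] at h1
    have h5 := hz m (by omega)
    rw [← hs] at h5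
    have h6 := hL s hs1 s hs1 (ζ m) (y s)
    rw [sub_self, abs_zero, zero_add] at h6
    have h7 := hζ m (by omega)
    have h8 : ‖ζ m - y s‖ ≤ (h * M + η) + ‖z m - y s‖ :=
      (norm_sub_le_norm_sub_add_norm_sub _ (z m) _).trans (by linarith)
    have h9 : z (m + 1) - y (s + h) = (z (m + 1) - z m - h • X s (ζ m)) + (z m - y s)
        + h • (X s (ζ m) - X s (y s))
        - ((y (s + h) - (s + h) • X s (y s)) - (y s - s • X s (y s))) := by
      module
    have h10 : ‖z (m + 1) - y (s + h)‖ ≤ η + ‖z m - y s‖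
        + h * (L * ((h * M + η) + ‖z m - y s‖)) + (L * (1 + M) * h) * h := by
      rw [h9]
      refine (norm_sub_le _ _).trans (add_le_add ((norm_add_le _ _).trans (add_le_add
        ((norm_add_le _ _).trans (add_le_add h5 le_rfl)) ?_)) h1)
      rw [norm_smul, Real.norm_of_nonneg hh]
      exact mul_le_mul_of_nonneg_left (h6.trans (mul_le_mul_of_nonneg_left h8 hL0)) hh
    have h11 : t₁ + ((m + 1 : ℕ) : ℝ) * h = s + h := by push_cast; ring
    rw [h11]
    set A := L * (1 + 2 * M) * h ^ 2 + (1 + h * L) * η with hA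
    have hA0 : 0 ≤ A := by positivity
    have h12 : η + ‖z m - y s‖ + h * (L * ((h * M + η) + ‖z m - y s‖)) + (L * (1 + M) * h) * h
        = (1 + h * L) * ‖z m - y s‖ + A := by rw [hA]; ring
    have h13 : (1 + h * L) * ‖z m - y s‖ ≤ (1 + h * L) * (m * A * (1 + h * L) ^ m) :=
      mul_le_mul_of_nonneg_left ih (by positivity)
    have h14 : A ≤ A * (1 + h * L) ^ (m + 1) :=
      le_mul_of_one_le_right hA0 (one_le_pow₀ (by nlinarith))
    push_cast
    rw [h12] at h10
    have h15 : (m + 1) * A * (1 + h * L) ^ (m + 1)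
        = (1 + h * L) * (m * A * (1 + h * L) ^ m) + A * (1 + h * L) ^ (m + 1) := by ring
    linarith

theorem norm_le_of_forall_abs_inner_le {V : Type*} [NormedAddCommGroup V] [InnerProductSpace ℝ V]
    {u : V} {c : ℝ} (hc : 0 ≤ c) (h : ∀ v, |inner ℝ v u| ≤ c * ‖v‖) : ‖u‖ ≤ c := by
  have h1 := h u
  rw [real_inner_self_eq_norm_sq, abs_of_nonneg (by positivity)] at h1
  by_contra! h2
  nlinarith [norm_nonneg u]

section HamiltonianVectorField

variable {n : ℕ} {G : ℝ × Phase n → ℝ}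

theorem inner_hamVF_fst (hG : Differentiable ℝ G) (t : ℝ) (x : Phase n)
    (v : EuclideanSpace ℝ (Fin n)) :
    inner ℝ v (hamVF G t x).1 = fderiv ℝ (fun x => G (t, x)) x (0, v) := by
  have hGt : Differentiable ℝ (fun x => G (t, x)) := by fun_prop
  have h1 : HasFDerivAt (fun p => G (t, (x.1, p))) ((fderiv ℝ (fun x => G (t, x)) x).comp
      (ContinuousLinearMap.inr ℝ _ _)) x.2 :=
    HasFDerivAt.comp x.2 (g := fun x => G (t, x)) (f := fun p => (x.1, p)) (hGt x).hasFDerivAt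
      (hasFDerivAt_prodMk_right x.1 x.2)
  rw [hamVF, inner_gradient_right, h1.fderiv]
  simp

theorem inner_hamVF_snd (hG : Differentiable ℝ G) (t : ℝ) (x : Phase n)
    (v : EuclideanSpace ℝ (Fin n)) :
    inner ℝ v (hamVF G t x).2 = -fderiv ℝ (fun x => G (t, x)) x (v, 0) := by
  have hGt : Differentiable ℝ (fun x => G (t, x)) := by fun_prop
  have h1 : HasFDerivAt (fun q => G (t, (q, x.2))) ((fderiv ℝ (fun x => G (t, x)) x).comp
      (ContinuousLinearMap.inl ℝ _ _)) x.1 :=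
    HasFDerivAt.comp x.1 (g := fun x => G (t, x)) (f := fun q => (q, x.2)) (hGt x).hasFDerivAt
      (hasFDerivAt_prodMk_left x.1 x.2)
  rw [hamVF, inner_neg_right, inner_gradient_right, h1.fderiv]
  simp

theorem norm_hamVF_sub_le (hG : Differentiable ℝ G) (t s : ℝ) (x y : Phase n) :
    ‖hamVF G t x - hamVF G s y‖
      ≤ ‖fderiv ℝ (fun x => G (t, x)) x - fderiv ℝ (fun x => G (s, x)) y‖ := by
  refine max_le (norm_le_of_forall_abs_inner_le (norm_nonneg _) fun v => ?_)
    (norm_le_of_forall_abs_inner_le (norm_nonneg _) fun v => ?_)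
  · rw [Prod.fst_sub, inner_sub_right, inner_hamVF_fst hG, inner_hamVF_fst hG, ← sub_apply,
      ← Real.norm_eq_abs]
    simpa using (fderiv ℝ (fun x => G (t, x)) x
      - fderiv ℝ (fun x => G (s, x)) y).le_opNorm (0, v)
  · rw [Prod.snd_sub, inner_sub_right, inner_hamVF_snd hG, inner_hamVF_snd hG, neg_sub_neg,
      abs_sub_comm, ← sub_apply, ← Real.norm_eq_abs]
    simpa using (fderiv ℝ (fun x => G (t, x)) x
      - fderiv ℝ (fun x => G (s, x)) y).le_opNorm (v, 0)

theorem norm_hamVF_le (hG : Differentiable ℝ G) (t : ℝ) (x : Phase n) :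
    ‖hamVF G t x‖ ≤ ‖fderiv ℝ (fun x => G (t, x)) x‖ := by
  refine max_le (norm_le_of_forall_abs_inner_le (norm_nonneg _) fun v => ?_)
    (norm_le_of_forall_abs_inner_le (norm_nonneg _) fun v => ?_)
  · rw [inner_hamVF_fst hG, ← Real.norm_eq_abs]
    simpa using (fderiv ℝ (fun x => G (t, x)) x).le_opNorm (0, v)
  · rw [inner_hamVF_snd hG, abs_neg, ← Real.norm_eq_abs]
    simpa using (fderiv ℝ (fun x => G (t, x)) x).le_opNorm (v, 0)

end HamiltonianVectorField

/-- Choice of the mesh `h = δ / N` and of the error `η` for which the Euler scheme is accurate. -/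
theorem exists_mesh {L S δ θ B ρ : ℝ} (hL0 : 0 ≤ L) (hS0 : 0 ≤ S) (hδ : 0 < δ) (hδ1 : δ ≤ 1)
    (hθ0 : 0 < θ) (hB : 0 < B) (hρ : 0 < ρ) :
    ∃ (N : ℕ) (h η : ℝ), 0 < N ∧ 0 < h ∧ N * h = δ ∧ 0 < η ∧ η ≤ θ / 2 ∧ h * S ≤ θ / 2 ∧
      N * (η * ρ) ≤ B / 2 * ρ ^ 2 ∧ ∀ m : ℕ, m ≤ N →
        m * (L * (1 + 2 * S) * h ^ 2 + (1 + h * L) * η) * (1 + h * L) ^ m ≤ θ := by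
  set A := Real.exp L with hA
  have hA1 : 1 ≤ A := Real.one_le_exp hL0
  obtain ⟨N, hN⟩ := exists_nat_gt (2 * (L * (1 + 2 * S) * A + S + 1) / θ)
  have hNpos : (0 : ℝ) < N := lt_of_le_of_lt (by positivity) hN
  have hN0 : 0 < N := by exact_mod_cast hNpos
  have hN1 : (1 : ℝ) ≤ N := by exact_mod_cast hN0
  rw [div_lt_iff₀ hθ0] at hN
  set h := δ / N with hh
  have hh0 : 0 < h := by positivity
  have hNh : N * h = δ := by rw [hh]; field_simp
  have hh1 : h ≤ 1 := by nlinarith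
  obtain ⟨η, hη0, hη1, hη2⟩ : ∃ η, 0 < η ∧ N * ((1 + L) * η) * A ≤ θ / 2 ∧
      N * (η * ρ) ≤ B / 2 * ρ ^ 2 := by
    refine ⟨min (θ / 2 / (N * (1 + L) * A)) (B / 2 * ρ / N), by positivity, ?_, ?_⟩
    · have h1 : min (θ / 2 / (N * (1 + L) * A)) (B / 2 * ρ / N) * (N * (1 + L) * A) ≤ θ / 2 := by
        rw [← le_div_iff₀ (by positivity)]
        exact min_le_left _ _
      linarith
    · have h1 : min (θ / 2 / (N * (1 + L) * A)) (B / 2 * ρ / N) * N ≤ B / 2 * ρ := by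
        rw [← le_div_iff₀ (by positivity)]
        exact min_le_right _ _
      nlinarith
  have hηθ : η ≤ θ / 2 := by
    refine le_trans ?_ hη1
    have h1 : η ≤ (1 + L) * η := by nlinarith
    have h2 : (1 + L) * η ≤ N * ((1 + L) * η) := le_mul_of_one_le_left (by positivity) hN1
    have h3 : N * ((1 + L) * η) ≤ N * ((1 + L) * η) * A :=
      le_mul_of_one_le_right (by positivity) hA1
    linarith
  have hhC : h * (2 * (L * (1 + 2 * S) * A + S + 1)) ≤ θ := by
    have h1 : h * (2 * (L * (1 + 2 * S) * A + S + 1)) ≤ h * (θ * N) :=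
      mul_le_mul_of_nonneg_left (by linarith) hh0.le
    nlinarith
  have hAS : 0 ≤ L * (1 + 2 * S) * A := by positivity
  have hhS : h * S ≤ θ / 2 := by nlinarith
  have hhL : h * (L * (1 + 2 * S) * A) ≤ θ / 2 := by nlinarith
  refine ⟨N, h, η, hN0, hh0, hNh, hη0, hηθ, hhS, hη2, fun m hm => ?_⟩
  have hmN : (m : ℝ) ≤ N := by exact_mod_cast hm
  have h2 : (1 + h * L) ^ m ≤ A := by
    calc (1 + h * L) ^ m ≤ Real.exp (h * L) ^ m :=
          pow_le_pow_left₀ (by positivity) (by linarith [Real.add_one_le_exp (h * L)]) m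
      _ = Real.exp (m * (h * L)) := (Real.exp_nat_mul _ _).symm
      _ ≤ A := Real.exp_le_exp.2 (by
          have h3 : m * h ≤ N * h := mul_le_mul_of_nonneg_right hmN hh0.le
          have h4 : m * h * L ≤ 1 * L := mul_le_mul_of_nonneg_right (by linarith) hL0
          linarith)
  have h3 : h * L ≤ 1 * L := mul_le_mul_of_nonneg_right hh1 hL0
  have h4 : N * h * (h * (L * (1 + 2 * S) * A)) ≤ 1 * (θ / 2) :=
    mul_le_mul (by linarith) hhL (by positivity) zero_le_one
  calc m * (L * (1 + 2 * S) * h ^ 2 + (1 + h * L) * η) * (1 + h * L) ^ m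
      ≤ N * (L * (1 + 2 * S) * h ^ 2 + (1 + 1 * L) * η) * A := by gcongr
    _ = N * h * (h * (L * (1 + 2 * S) * A)) + N * ((1 + L) * η) * A := by ring
    _ ≤ θ := by linarith

/-- If the Hamiltonian flow of `G` is close to the identity and `G` vanishes near `x₁`, then the
action of the almost closed trajectories near `x₁` is small, which bounds from above any quadratic
lower bound of `-G`. -/
theorem action_le_of_flow_close_to_id {n : ℕ} {G : ℝ × Phase n → ℝ} (hG : ContDiff ℝ 2 G)
    {K : Set (Phase n)} (hK : IsCompact K)
    (hGK : ∀ t ∈ Set.Icc (0 : ℝ) 1, (Function.support fun x => G (t, x)) ⊆ K)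
    {φ : ℝ × Phase n → Phase n} (hφ : IsHamFlow G φ) {ε : ℝ}
    (hε : ∀ t ∈ Set.Icc (0 : ℝ) 1, ∀ x, dist (φ (t, x)) x ≤ ε)
    {x₁ : Phase n} (hx₁ : ∀ x, ‖x‖ ≤ 1 → x₁ + x ∉ K) {t₁ δ B ρ a κ M : ℝ} (ht₁ : 0 ≤ t₁)
    (hδ : 0 < δ) (htδ : t₁ + δ ≤ 1) (hB : 0 < B) (hρ : 0 < ρ) (hρ1 : ρ ≤ 1)
    (hερ : 8 * (B + 2) * ε ≤ ρ) (hκ : 0 ≤ κ) (hκδ : 2 * κ * δ ≤ 1)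
    {w : EuclideanSpace ℝ (Fin n)}
    (hlow : ∀ t ∈ Set.Icc t₁ (t₁ + δ), ∀ q p,
      a - κ * (‖q‖ ^ 2 + ‖p - w‖ ^ 2) ≤ -G (t, x₁ + (q, p)))
    (hM : ∀ t ∈ Set.Icc (0 : ℝ) 1, ∀ x, -M ≤ G (t, x)) :
    δ * a - ‖w‖ ^ 2 / (2 * B) ≤ B * ρ ^ 2 := by
  have hGd : Differentiable ℝ G := hG.differentiable (by norm_num)
  obtain ⟨hD0, L, S, hL0, hS0, hS, hL⟩ := exists_lipschitz_bound_fderiv_slice hG hK hGK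
  have hXS : ∀ t ∈ Set.Icc (0 : ℝ) 1, ∀ x, ‖hamVF G t x‖ ≤ S := fun t ht x =>
    (norm_hamVF_le hGd t x).trans (hS t ht x)
  have hXL : ∀ t ∈ Set.Icc (0 : ℝ) 1, ∀ s ∈ Set.Icc (0 : ℝ) 1, ∀ x y,
      ‖hamVF G t x - hamVF G s y‖ ≤ L * (|t - s| + ‖x - y‖) := fun t ht s hs x y =>
    (norm_hamVF_sub_le hGd t s x y).trans (hL t ht s hs x y)
  set θ := ρ / (8 * (B + 2)) with hθ
  have hθ0 : 0 < θ := by positivity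
  have hεθ : ε ≤ θ := by
    rw [hθ, le_div_iff₀ (by positivity)]
    linarith
  have hρθ : ρ = 8 * (B + 2) * θ := by
    rw [hθ]
    field_simp
  have hδ1 : δ ≤ 1 := by linarith
  clear_value θ
  obtain ⟨N, h, η, hN0, hh0, hNh, hη0, hηθ, hhS, hη2, hmesh⟩ :=
    exists_mesh hL0 hS0 hδ hδ1 hθ0 hB hρ
  set τ : ℕ → ℝ := fun k => t₁ + (min k N : ℕ) * h with hτ
  have hτk : ∀ k ≤ N, τ k = t₁ + k * h := fun k hk => by simp [hτ, hk]
  have hτδ : ∀ k, τ k ∈ Set.Icc t₁ (t₁ + δ) := by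
    intro k
    have h1 : ((min k N : ℕ) : ℝ) ≤ N := by exact_mod_cast min_le_right k N
    refine ⟨le_add_of_nonneg_right (by positivity), ?_⟩
    have h2 := mul_le_mul_of_nonneg_right h1 hh0.le
    rw [hNh] at h2
    exact add_le_add_right h2 t₁
  have hτ1 : ∀ k, τ k ∈ Set.Icc (0 : ℝ) 1 := fun k =>
    ⟨ht₁.trans (hτδ k).1, (hτδ k).2.trans htδ⟩
  have hshift : ∀ t x, fderiv ℝ (fun x => G (t, x₁ + x)) x
      = fderiv ℝ (fun x => G (t, x)) (x₁ + x) := fun t x =>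
    fderiv_comp_add_left (f := fun x => G (t, x)) x₁
  obtain ⟨q, p, hqN, hact, hq, hp, hqp0⟩ := exists_almost_hamiltonian_sequence
    (F := fun k x => G (τ k, x₁ + x)) (N := N) (h := h) (B := B) (a := a) (κ := κ) (M := M) (w := w)
    (fun k => by
      refine ⟨by fun_prop, L, fun x y => ?_⟩
      rw [hshift, hshift]
      have := hL (τ k) (hτ1 k) (τ k) (hτ1 k) (x₁ + x) (x₁ + y)
      rwa [sub_self, abs_zero, zero_add, add_sub_add_left_eq_sub] at this)
    hh0.le hB hκ (fun k q p => hlow _ (hτδ k) q p) (by rw [hNh]; exact hκδ)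
    (fun k x => hM _ (hτ1 k) _) hη0
  have hqp := norm_le_of_forall_abs_inner_le hη0.le (hqp0 hN0)
  simp only [hshift] at hq hp
  rw [hNh] at hact
  obtain ⟨x₀, hx₀⟩ := exists_trajectory_through hL0 hS0 hXS hXL hφ.1 hφ.2
    (t₁ := t₁) ⟨ht₁, by linarith⟩ (x₁ + (q 0, p 0))
  have hdq : ∀ k < N, ‖q (k + 1) - q k‖ ≤ h * S + η := by
    intro k hk
    refine norm_le_of_forall_abs_inner_le (by positivity) fun v => ?_
    have h1 := hq k hk v
    have h2 : |h * fderiv ℝ (fun x => G (τ k, x)) (x₁ + (q (k + 1), p k)) (0, v)|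
        ≤ h * (S * ‖v‖) := by
      rw [abs_mul, abs_of_pos hh0, ← Real.norm_eq_abs]
      refine mul_le_mul_of_nonneg_left ?_ hh0.le
      simpa using (fderiv ℝ (fun x => G (τ k, x)) (x₁ + (q (k + 1), p k))).le_of_opNorm_le
        (hS _ (hτ1 k) _) (0, v)
    have h3 := abs_sub_abs_le_abs_sub (inner ℝ v (q (k + 1) - q k))
      (h * fderiv ℝ (fun x => G (τ k, x)) (x₁ + (q (k + 1), p k)) (0, v))
    linarith
  have hclose : ∀ m < N, ‖(q m, p m) - (q 0, p 0)‖ ≤ 3 * θ := by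
    intro m hm
    have hmN : (m : ℝ) + 1 ≤ N := by exact_mod_cast hm
    have hmh : t₁ + m * h ≤ 1 := by nlinarith
    have hmt : t₁ + m * h ∈ Set.Icc (0 : ℝ) 1 := ⟨by positivity, hmh⟩
    have h1 := norm_euler_sub_le hL0 hS0 hXS hXL (hφ.2 x₀) ht₁ hh0.le hη0.le (m := m) hmh
      (z := fun k => x₁ + (q k, p k)) (ζ := fun k => x₁ + (q (k + 1), p k)) hx₀.symm
      (fun k hk => by
        simpa using hdq k (by omega))
      (fun k hk => by
        simp only [add_sub_add_left_eq_sub]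
        rw [← hτk k (by omega)]
        refine max_le (norm_le_of_forall_abs_inner_le hη0.le fun v => ?_)
          (norm_le_of_forall_abs_inner_le hη0.le fun v => ?_)
        · have := hq k (by omega) v
          rw [← inner_hamVF_fst hGd, ← real_inner_smul_right, ← inner_sub_right] at this
          exact this
        · have := hp k (by omega) v
          rw [← neg_neg (fderiv ℝ (fun x => G (τ k, x)) (x₁ + (q (k + 1), p k)) (v, 0)),
            ← inner_hamVF_snd hGd, mul_neg, ← sub_eq_add_neg, ← real_inner_smul_right,
            ← inner_sub_right] at this
          exact this)
    have h3 := hmesh m hm.le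
    have h4 : ‖φ (t₁ + m * h, x₀) - φ (t₁, x₀)‖ ≤ 2 * θ := by
      have h5 := hε _ hmt x₀
      have h6 := hε t₁ ⟨ht₁, by linarith⟩ x₀
      rw [← dist_eq_norm]
      linarith [dist_triangle_right (φ (t₁ + m * h, x₀)) (φ (t₁, x₀)) x₀]
    have h7 : (q m, p m) - (q 0, p 0) = (x₁ + (q m, p m) - φ (t₁ + m * h, x₀))
        + (φ (t₁ + m * h, x₀) - φ (t₁, x₀)) := by
      rw [hx₀]
      abel
    rw [h7]
    linarith [norm_add_le (x₁ + (q m, p m) - φ (t₁ + m * h, x₀))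
      (φ (t₁ + m * h, x₀) - φ (t₁, x₀))]
  have hcq : ∀ m < N, ‖q m - q 0‖ ≤ 3 * θ := fun m hm => (le_max_left _ _).trans (hclose m hm)
  have hcp : ∀ m < N, ‖p m - p 0‖ ≤ 3 * θ := fun m hm => (le_max_right _ _).trans (hclose m hm)
  have hq0 : ‖q 0‖ ≤ 4 * θ := by
    have h1 := hcq (N - 1) (by omega)
    have h2 := hdq (N - 1) (by omega)
    rw [Nat.sub_add_cancel hN0, hqN, zero_sub, norm_neg] at h2
    linarith [norm_le_norm_add_norm_sub' (q 0) (q (N - 1)), norm_sub_rev (q 0) (q (N - 1))]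
  have hp0 : ‖p 0‖ ≤ (4 * B + 1) * θ := by
    have h1 := norm_le_norm_add_norm_sub' (p 0) (B • q 0)
    rw [norm_smul, Real.norm_of_nonneg hB.le] at h1
    nlinarith
  have hBθ : 0 < B * θ := by positivity
  have hqρ : ∀ k ≤ N, ‖q k‖ ≤ ρ := by
    intro k hk
    rcases hk.eq_or_lt with rfl | hk
    · rw [hqN, norm_zero]
      exact hρ.le
    · linarith [hcq k hk, norm_le_norm_add_norm_sub' (q k) (q 0)]
  have hpρ : ∀ k < N, ‖p k‖ ≤ ρ := by
    intro k hk
    linarith [hcp k hk, norm_le_norm_add_norm_sub' (p k) (p 0)]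
  have hterm : ∀ k ∈ Finset.range N, inner ℝ (p k) (q (k + 1) - q k)
      + -h * G (τ k, x₁ + (q (k + 1), p k)) ≤ η * ρ := by
    intro k hk
    have hk := Finset.mem_range.1 hk
    have hnot := hx₁ (q (k + 1), p k) (max_le ((hqρ _ hk).trans hρ1) ((hpρ _ hk).trans hρ1))
    have h1 : G (τ k, x₁ + (q (k + 1), p k)) = 0 := by
      by_contra h2
      exact hnot (hGK _ (hτ1 k) h2)
    have h2 := hq k hk (p k)
    rw [hD0 _ (hτ1 k) _ hnot] at h2
    simp only [zero_apply, mul_zero, sub_zero] at h2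
    rw [h1, mul_zero, add_zero]
    exact (le_abs_self _).trans (h2.trans (mul_le_mul_of_nonneg_left (hpρ k hk) hη0.le))
  have hsum := Finset.sum_le_sum hterm
  rw [Finset.sum_const, Finset.card_range, nsmul_eq_mul] at hsum
  have hq0' : B / 2 * inner ℝ (q 0) (q 0) ≤ B / 2 * ρ ^ 2 := by
    rw [real_inner_self_eq_norm_sq]
    gcongr
    exact hqρ 0 hN0.le
  rw [discreteAction] at hact
  linarith
/-- One half of the uniqueness statement: the limit Hamiltonian is nonnegative. -/
theorem limit_nonneg_of_flow_tendsto_id {n : ℕ} (hn : 1 ≤ n)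
    {H : ℕ → ℝ × Phase n → ℝ} {Hlim : ℝ × Phase n → ℝ} {φ : ℕ → ℝ × Phase n → Phase n}
    (hsmooth : ∀ i, ContDiff ℝ 2 (H i)) {K : Set (Phase n)} (hK : IsCompact K)
    (hsupp : ∀ i, ∀ t ∈ Set.Icc (0 : ℝ) 1, (Function.support fun x => H i (t, x)) ⊆ K)
    (hflow : ∀ i, IsHamFlow (H i) (φ i)) (hHlim : Continuous Hlim)
    (hHconv : ∀ ε > 0, ∃ N, ∀ i ≥ N, ∀ t ∈ Set.Icc (0 : ℝ) 1, ∀ x : Phase n,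
      |H i (t, x) - Hlim (t, x)| < ε)
    (hφconv : ∀ ε > 0, ∃ N, ∀ i ≥ N, ∀ t ∈ Set.Icc (0 : ℝ) 1, ∀ x : Phase n,
      dist (φ i (t, x)) x < ε)
    {t : ℝ} (ht : t ∈ Set.Icc (0 : ℝ) 1) (e : Phase n) : 0 ≤ Hlim (t, e) := by
  by_contra! hneg
  obtain ⟨a, ha, hae⟩ : ∃ a > 0, Hlim (t, e) = -(3 * a) :=
    ⟨-Hlim (t, e) / 3, by linarith, by ring⟩
  obtain ⟨M₀, hM₀, hbound⟩ : ∃ M₀, 0 ≤ M₀ ∧ ∀ s ∈ Set.Icc (0 : ℝ) 1, ∀ x, |Hlim (s, x)| ≤ M₀ := by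
    obtain ⟨C, hC⟩ := ((isCompact_Icc (a := (0 : ℝ)) (b := 1)).prod hK).exists_bound_of_continuousOn
      hHlim.continuousOn
    refine ⟨max C 0, le_max_right _ _, fun s hs x => ?_⟩
    by_cases hx : x ∈ K
    · exact (hC (s, x) ⟨hs, hx⟩).trans (le_max_left _ _)
    · refine le_max_of_le_right (le_of_forall_pos_lt_add fun ε hε => ?_)
      obtain ⟨N, hN⟩ := hHconv ε hε
      have h1 : H N (s, x) = 0 := by
        by_contra h2
        exact hx (hsupp N s hs h2)
      simpa [h1] using hN N le_rfl s hs x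
  obtain ⟨r, hr, hrball⟩ : ∃ r > 0, ∀ y, dist y (t, e) < r → Hlim y < -(2 * a) :=
    Metric.eventually_nhds_iff.1 (hHlim.continuousAt.eventually_lt_const (by linarith))
  set κ := (M₀ + 2 * a) / r ^ 2 with hκ
  have hκ0 : 0 < κ := by positivity
  have hκr : κ * r ^ 2 = M₀ + 2 * a := by rw [hκ]; field_simp
  obtain ⟨δ, hδ0, hδr, hδ1, hδκ⟩ : ∃ δ > 0, δ < r ∧ δ ≤ 1 ∧ 2 * κ * δ ≤ 1 := by
    refine ⟨min (r / 2) (min 1 (1 / (2 * κ))), by positivity, ?_, ?_, ?_⟩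
    · exact (min_le_left _ _).trans_lt (by linarith)
    · exact (min_le_right _ _).trans (min_le_left _ _)
    · rw [mul_comm, ← le_div_iff₀ (by positivity)]
      exact (min_le_right _ _).trans (min_le_right _ _)
  obtain ⟨t₁, ht₁, htδ, htr⟩ : ∃ t₁, 0 ≤ t₁ ∧ t₁ + δ ≤ 1 ∧
      ∀ s ∈ Set.Icc t₁ (t₁ + δ), |s - t| < r := by
    rcases le_total (t + δ) 1 with h1 | h1
    · exact ⟨t, ht.1, h1, fun s hs => abs_lt.2 ⟨by linarith [hs.1], by linarith [hs.2]⟩⟩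
    · exact ⟨1 - δ, by linarith, by linarith, fun s hs =>
        abs_lt.2 ⟨by linarith [hs.1, ht.2], by linarith [hs.2]⟩⟩
  have hquad : ∀ s ∈ Set.Icc t₁ (t₁ + δ), ∀ x,
      2 * a - κ * (‖x.1 - e.1‖ ^ 2 + ‖x.2 - e.2‖ ^ 2) ≤ -Hlim (s, x) := by
    intro s hs x
    by_cases hx : dist x e < r
    · have h1 := hrball (s, x) (max_lt (htr s hs) hx)
      have h2 : 0 ≤ κ * (‖x.1 - e.1‖ ^ 2 + ‖x.2 - e.2‖ ^ 2) := by positivity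
      linarith
    · have h1 : r ^ 2 ≤ ‖x.1 - e.1‖ ^ 2 + ‖x.2 - e.2‖ ^ 2 := by
        rw [Prod.dist_eq, dist_eq_norm, dist_eq_norm, max_lt_iff, not_and_or, not_lt, not_lt] at hx
        rcases hx with hx | hx
        · linarith [pow_le_pow_left₀ hr.le hx 2, sq_nonneg ‖x.2 - e.2‖]
        · linarith [pow_le_pow_left₀ hr.le hx 2, sq_nonneg ‖x.1 - e.1‖]
      have h2 := mul_le_mul_of_nonneg_left h1 hκ0.le
      have h3 := (abs_le.1 (hbound s ⟨ht₁.trans hs.1, hs.2.trans htδ⟩ x)).2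
      linarith
  obtain ⟨R, hR⟩ := hK.isBounded.exists_norm_le
  obtain ⟨c, hfar⟩ : ∃ c, ∀ x : Phase n, ‖x‖ ≤ 1 → (e.1, c) + x ∉ K := by
    refine ⟨EuclideanSpace.single ⟨0, hn⟩ (|R| + 2), fun x hx hxK => ?_⟩
    have h1 := (norm_snd_le _).trans (hR _ hxK)
    have h2 := (norm_snd_le x).trans hx
    have h3 := norm_sub_le (EuclideanSpace.single ⟨0, hn⟩ (|R| + 2) + x.2) x.2
    rw [add_sub_cancel_right, PiLp.norm_single, Real.norm_of_nonneg (by positivity)] at h3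
    rw [Prod.snd_add] at h1
    linarith [le_abs_self R]
  obtain ⟨w, hw⟩ : ∃ w, w = e.2 - c := ⟨_, rfl⟩
  set B := (‖w‖ ^ 2 + 1) / (δ * a) with hB
  have hB0 : 0 < B := by positivity
  have hwB : ‖w‖ ^ 2 / (2 * B) < δ * a / 2 := by
    have h1 : B * (δ * a) = ‖w‖ ^ 2 + 1 := by rw [hB]; field_simp
    rw [div_lt_iff₀ (by positivity)]
    linarith
  obtain ⟨ρ, hρ0, hρ1, hρB⟩ : ∃ ρ > 0, ρ ≤ 1 ∧ B * ρ ^ 2 ≤ δ * a / 2 := by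
    refine ⟨min 1 (δ * a / (2 * B)), by positivity, min_le_left _ _, ?_⟩
    have h1 := min_le_left 1 (δ * a / (2 * B))
    have h2 := min_le_right 1 (δ * a / (2 * B))
    have h3 : 0 < min 1 (δ * a / (2 * B)) := by positivity
    rw [le_div_iff₀ (by positivity)] at h2
    have h4 := mul_le_mul_of_nonneg_left (mul_le_of_le_one_left h3.le h1) hB0.le
    rw [sq]
    linarith
  obtain ⟨N₁, hN₁⟩ := hHconv a ha
  obtain ⟨N₂, hN₂⟩ := hφconv (ρ / (8 * (B + 2))) (by positivity)
  have hN₁ := hN₁ _ (le_max_left N₁ N₂)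
  have hN₂ := hN₂ _ (le_max_right N₁ N₂)
  have key := action_le_of_flow_close_to_id (hsmooth (max N₁ N₂)) hK (hsupp _) (hflow _)
    (fun s hs x => (hN₂ s hs x).le) hfar ht₁ hδ0 htδ hB0 hρ0 hρ1
    (mul_div_cancel₀ _ (by positivity)).le hκ0.le hδκ (w := w) (a := a) (M := M₀ + a)
    (fun s hs q p => by
      have h1 := (abs_lt.1 (hN₁ s ⟨ht₁.trans hs.1, hs.2.trans htδ⟩ ((e.1, c) + (q, p)))).2
      have h2 := hquad s hs ((e.1, c) + (q, p))
      have h3 : e.1 + q - e.1 = q := by abel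
      have h4 : c + p - e.2 = p - w := by rw [hw]; abel
      simp only [Prod.mk_add_mk, h3, h4] at h1 h2 ⊢
      linarith)
    (fun s hs x => by
      have h1 := (abs_lt.1 (hN₁ s hs x)).1
      have h2 := (abs_le.1 (hbound s hs x)).1
      linarith)
  linarith

/-- Time-reversal symmetry: reflecting momenta and negating the Hamiltonian reflects the flow. -/
theorem IsHamFlow.reflect {n : ℕ} {H : ℝ × Phase n → ℝ} {φ : ℝ × Phase n → Phase n}
    (hφ : IsHamFlow H φ) :
    IsHamFlow (fun z => -H (z.1, (z.2.1, -z.2.2)))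
      (fun z => ((φ (z.1, (z.2.1, -z.2.2))).1, -(φ (z.1, (z.2.1, -z.2.2))).2)) := by
  refine ⟨fun x => by simp [hφ.1], fun x t ht => ?_⟩
  have h := hφ.2 (x.1, -x.2) t ht
  set y := φ (t, (x.1, -x.2))
  have hvf : hamVF (fun z => -H (z.1, (z.2.1, -z.2.2))) t (y.1, -y.2)
      = ((hamVF H t y).1, -(hamVF H t y).2) := by
    have h1 : fderiv ℝ (fun p => -H (t, (y.1, -p))) (-y.2)
        = fderiv ℝ (fun p => H (t, (y.1, p))) y.2 := by
      rw [fderiv_fun_neg]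
      have := (ContinuousLinearEquiv.neg ℝ (M := EuclideanSpace ℝ (Fin n))).comp_right_fderiv
        (f := fun p => H (t, (y.1, p))) (x := -y.2)
      ext v
      simpa [Function.comp_def] using congrArg Neg.neg (DFunLike.congr_fun this v)
    simp [hamVF, gradient, h1]
  have h2 : HasDerivAt (fun s => ((φ (s, (x.1, -x.2))).1, -(φ (s, (x.1, -x.2))).2))
      ((hamVF H t y).1, -(hamVF H t y).2) t :=
    let V := EuclideanSpace ℝ (Fin n)
    have h3 := (ContinuousLinearMap.fst ℝ V V).hasFDerivAt.comp_hasDerivAt t h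
    have h4 := (ContinuousLinearMap.snd ℝ V V).hasFDerivAt.comp_hasDerivAt t h
    h3.prodMk h4.neg
  rw [← hvf] at h2
  exact h2

/-- C⁰-uniqueness of compactly supported continuous Hamiltonians, instantiated on
standard `(ℝ^{2n}, ω₀)`, which is bounded at infinity. -/
theorem uniqueness_compactly_supported (n : ℕ) (hn : 1 ≤ n)
    (H : ℕ → ℝ × Phase n → ℝ) (Hlim : ℝ × Phase n → ℝ)
    (φ : ℕ → ℝ × Phase n → Phase n)
    (hsmooth : ∀ i, ContDiff ℝ (⊤ : ℕ∞) (H i))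
    (K : Set (Phase n)) (hK : IsCompact K)
    (hsupp : ∀ i, ∀ t ∈ Set.Icc (0:ℝ) 1,
      (Function.support fun x => H i (t, x)) ⊆ K)
    (hflow : ∀ i, IsHamFlow (H i) (φ i))
    (hHlim : Continuous Hlim)
    (hHconv : ∀ ε > 0, ∃ N, ∀ i ≥ N, ∀ t ∈ Set.Icc (0:ℝ) 1, ∀ x : Phase n,
      |H i (t, x) - Hlim (t, x)| < ε)
    (hφconv : ∀ ε > 0, ∃ N, ∀ i ≥ N, ∀ t ∈ Set.Icc (0:ℝ) 1, ∀ x : Phase n,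
      dist (φ i (t, x)) x < ε) :
    ∀ t ∈ Set.Icc (0:ℝ) 1, ∀ x : Phase n, Hlim (t, x) = 0 := by
  intro t ht x
  have hH : ∀ i, ContDiff ℝ 2 (H i) := fun i => mod_cast contDiff_infty.1 (hsmooth i) 2
  refine le_antisymm ?_ (limit_nonneg_of_flow_tendsto_id hn hH hK hsupp hflow hHlim hHconv hφconv
    ht x)
  have hR : Continuous fun x : Phase n => (x.1, -x.2) := by fun_prop
  have key := limit_nonneg_of_flow_tendsto_id hn
    (H := fun i z => -H i (z.1, (z.2.1, -z.2.2))) (Hlim := fun z => -Hlim (z.1, (z.2.1, -z.2.2)))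
    (fun i => by have := hH i; fun_prop) (hK.image hR)
    (fun i t ht x hx => ⟨(x.1, -x.2), hsupp i t ht (by simpa using hx), by simp⟩)
    (fun i => (hflow i).reflect) (by fun_prop)
    (fun ε hε => by
      obtain ⟨N, hN⟩ := hHconv ε hε
      refine ⟨N, fun i hi t ht x => ?_⟩
      rw [neg_sub_neg, abs_sub_comm]
      exact hN i hi t ht _)
    (fun ε hε => by
      obtain ⟨N, hN⟩ := hφconv ε hε
      refine ⟨N, fun i hi t ht x => ?_⟩
      have h1 := hN i hi t ht (x.1, -x.2)
      rw [Prod.dist_eq, ← dist_neg_neg (φ i _).2] at h1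
      simpa only [neg_neg, Prod.dist_eq] using h1)
    ht (x.1, -x.2)
  simpa using key
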